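/- arXiv:1804.07752 — 2 statements merged into one kernel-verified Lean document; each statement's English description precedes it below -/
import Mathlib

section
/- Let (a,S) be a data pair with a = a* ∈ 𝒜 and S positivity-preserving and symmetric, and assume there is C > 0 with S[x] ≤ C⟨x⟩·1 for all x ∈ 𝒜̄₊; let m be the solution of the associated Dyson equation. Then: (i) for every τ ∈ ℝ∖supp ρ there exists m(τ) = m(τ)* ∈ 𝒜 such that lim_{η↓0} ‖m(τ+iη) − m(τ)‖ = 0, and the mass of (−∞,τ) under ρ is given by the band mass formula ρ((−∞,τ)) = ⟨χ_{(−∞,0)}(m(τ))⟩, where χ_{(−∞,0)}(m(τ)) is the spectral projection of the self-adjoint element m(τ) onto (−∞,0) via Borel functional calculus in 𝒜. (ii) If π : 𝒜 → ℂ^{n×n} is a faithful *-representation with ⟨x⟩ = n⁻¹Tr(π(x)) for all x ∈ 𝒜, then n·ρ(J) ∈ {1,…,n} for every connected component J of supp ρ; in particular supp ρ has at most n connected components. -/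
open MeasureTheory

noncomputable section

namespace Dyson

/-- A tracial, faithful, normal state on the C⋆-algebra `A` (our model for a finite
von Neumann algebra together with its canonical tracial state). -/
structure TracialState (A : Type*) [CStarAlgebra A] [PartialOrder A] where
  tr : A →ₗ[ℂ] ℂ
  unital : tr 1 = 1
  tracial : ∀ x y : A, tr (x * y) = tr (y * x)
  state_pos : ∀ x : A, 0 ≤ x → 0 ≤ (tr x).re ∧ (tr x).im = 0
  faithful : ∀ x : A, 0 ≤ x → tr x = 0 → x = 0
  cont : Continuous tr

/-- A positive-operator-valued measure on `ℝ`, recorded through its values on sets of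
reals together with the family of scalar measures `B ↦ ⟨x, v(B) x⟩`. -/
structure OpMeasure (A : Type*) [CStarAlgebra A] [PartialOrder A]
    (φ : TracialState A) where
  val : Set ℝ → A
  nonneg : ∀ B : Set ℝ, 0 ≤ val B
  scalar : A → Measure ℝ
  scalarFin : ∀ x : A, IsFiniteMeasure (scalar x)
  compat : ∀ (x : A) (B : Set ℝ), MeasurableSet B →
    φ.tr (star x * val B * x) = Complex.ofReal ((scalar x) B).toReal

variable {A : Type*} [CStarAlgebra A] [PartialOrder A] [StarOrderedRing A]

/-- The real part `(x + x*)/2`. -/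
def reA (x : A) : A := (2 : ℂ)⁻¹ • (x + star x)

/-- The imaginary part `(x − x*)/(2i)`. -/
def imA (x : A) : A := (2 * Complex.I)⁻¹ • (x - star x)

/-- Strictly positive (positive definite) elements, i.e. `x ≥ ε·1` for some `ε > 0`. -/
def IsPosDef (x : A) : Prop := ∃ ε : ℝ, 0 < ε ∧ Complex.ofReal ε • (1 : A) ≤ x

/-- The scalar product `⟨x, y⟩ = τ(x* y)` induced by the state. -/
def inner2 (φ : TracialState A) (x y : A) : ℂ := φ.tr (star x * y)

/-- The `L²`-norm `‖x‖₂ = ⟨x*x⟩^{1/2}` induced by the state. -/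
def nrm2 (φ : TracialState A) (x : A) : ℝ := Real.sqrt (φ.tr (star x * x)).re

/-- The `L² → L²` operator norm of a map on `A`. -/
def opNorm2 (φ : TracialState A) (f : A → A) : ℝ :=
  sInf {C : ℝ | 0 ≤ C ∧ ∀ x : A, nrm2 φ (f x) ≤ C * nrm2 φ x}

/-- `S` preserves the cone of positive semidefinite elements. -/
def PosPreserving (S : A →L[ℂ] A) : Prop := ∀ x : A, 0 ≤ x → 0 ≤ S x

/-- `S` is symmetric with respect to `⟨x, y⟩ = τ(x* y)`. -/
def SymmOp (φ : TracialState A) (S : A →L[ℂ] A) : Prop :=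
  ∀ x y : A, φ.tr (star (S x) * y) = φ.tr (star x * S y)

/-- Flatness: `c₁⟨x⟩·1 ≤ S[x] ≤ c₂⟨x⟩·1` for all positive semidefinite `x`. -/
def IsFlat (φ : TracialState A) (S : A →L[ℂ] A) (c₁ c₂ : ℝ) : Prop :=
  ∀ x : A, 0 ≤ x →
    Complex.ofReal (c₁ * (φ.tr x).re) • (1 : A) ≤ S x ∧
      S x ≤ Complex.ofReal (c₂ * (φ.tr x).re) • (1 : A)

/-- `m` solves the Dyson equation `−m(z)⁻¹ = z·1 − a + S[m(z)]` on the upper half-plane,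
with positive definite imaginary part. -/
def IsDysonSolution (a : A) (S : A →L[ℂ] A) (m : ℂ → A) : Prop :=
  ∀ z : ℂ, 0 < z.im →
    IsPosDef (imA (m z)) ∧
    m z * (z • (1 : A) - a + S (m z)) = -1 ∧
    (z • (1 : A) - a + S (m z)) * m z = -1

/-- The support of an operator-valued measure. -/
def OpMeasure.supp {φ : TracialState A} (v : OpMeasure A φ) : Set ℝ :=
  {t : ℝ | ∀ ε : ℝ, 0 < ε → v.val (Set.Ioo (t - ε) (t + ε)) ≠ 0}

/-- The self-consistent density of states `ρ = ⟨v⟩ = ⟨1, v(·) 1⟩`. -/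
def OpMeasure.dos {φ : TracialState A} (v : OpMeasure A φ) : Measure ℝ :=
  v.scalar 1

/-- `m` is the Stieltjes transform of `v`. -/
def StieltjesRep (φ : TracialState A) (v : OpMeasure A φ) (m : ℂ → A) : Prop :=
  ∀ z : ℂ, 0 < z.im → ∀ x : A,
    φ.tr (star x * m z * x) = ∫ t : ℝ, ((t : ℂ) - z)⁻¹ ∂(v.scalar x)

/-- The support of a (positive) measure on `ℝ`. -/
def measSupp (μ : Measure ℝ) : Set ℝ :=
  {t : ℝ | ∀ ε : ℝ, 0 < ε → μ (Set.Ioo (t - ε) (t + ε)) ≠ 0}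

/-- The harmonic extension `ρ(z) = ⟨Im m(z)⟩/π` of the density of states. -/
def rhoH (φ : TracialState A) (m : ℂ → A) (z : ℂ) : ℝ :=
  (φ.tr (imA (m z))).re / Real.pi

end Dyson

namespace Dyson

open Set Filter Topology

lemma isUnit_of_isUnit_star_mul {A : Type*} [CStarAlgebra A] {x : A}
    (h1 : IsUnit (star x * x)) (h2 : IsUnit (x * star x)) :
    IsUnit x := by
  obtain ⟨u, hu⟩ := h1.exists_left_inv
  obtain ⟨v, hv⟩ := h2.exists_right_inv
  have e1 : (u * star x) * x = 1 := by rw [mul_assoc, hu]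
  have e2 : x * (star x * v) = 1 := by rw [← mul_assoc, hv]
  have e3 := left_inv_eq_right_inv e1 e2
  exact isUnit_iff_exists.2 ⟨_, e2, by rw [← e3, e1]⟩

section CStar

variable {A : Type*} [CStarAlgebra A] [PartialOrder A] [StarOrderedRing A]

lemma norm_le_of_isSelfAdjoint {h : A} (hh : IsSelfAdjoint h) {K : ℝ} (hK : 0 ≤ K)
    (h1 : h ≤ algebraMap ℝ A K) (h2 : -h ≤ algebraMap ℝ A K) : ‖h‖ ≤ K := by
  rcases subsingleton_or_nontrivial A with _ | _
  · simpa [Subsingleton.elim h 0] using hK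
  rcases CStarAlgebra.norm_or_neg_norm_mem_spectrum (a := h) with h3 | h3
  · exact (le_algebraMap_iff_spectrum_le (a := h) (r := K)).1 h1 _ h3
  · have h4 : ‖h‖ ∈ spectrum ℝ (-h) := by
      rw [← spectrum.neg_eq, Set.mem_neg]; exact h3
    exact (le_algebraMap_iff_spectrum_le (a := -h) (r := K) (ha := hh.neg)).1 h2 _ h4

/-- An element whose real part is bounded below by `c > 0` is invertible, with inverse of norm
at most `1 / c`. -/
lemma isUnit_of_le_add_star {x : A} {c : ℝ} (hc : 0 < c)
    (hx : algebraMap ℝ A (2 * c) ≤ x + star x) :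
    IsUnit x ∧ c * ‖Ring.inverse x‖ ≤ 1 := by
  have hpos : IsStrictlyPositive (algebraMap ℝ A (c ^ 2)) :=
    ⟨algebraMap_nonneg A (by positivity), (IsUnit.mk0 (c ^ 2) (by positivity)).map (algebraMap ℝ A)⟩
  have cc : ∀ y : A, algebraMap ℝ A c * y = y * algebraMap ℝ A c := fun y => Algebra.commutes _ _
  have key : ∀ y : A, algebraMap ℝ A (2 * c) ≤ y + star y →
      algebraMap ℝ A (c ^ 2) ≤ star y * y := by
    intro y hy
    have h1 : 0 ≤ star (y - algebraMap ℝ A c) * (y - algebraMap ℝ A c) := star_mul_self_nonneg _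
    have h2 : 0 ≤ c • (y + star y - algebraMap ℝ A (2 * c)) :=
      smul_nonneg hc.le (sub_nonneg.2 hy)
    have h3 := add_nonneg h1 h2
    have h4 : star (y - algebraMap ℝ A c) * (y - algebraMap ℝ A c)
        + c • (y + star y - algebraMap ℝ A (2 * c)) = star y * y - algebraMap ℝ A (c ^ 2) := by
      have h5 : star (algebraMap ℝ A c) = algebraMap ℝ A c := by
        rw [← algebraMap_star_comm]; simp
      rw [star_sub, h5, Algebra.smul_def, map_mul, map_pow, map_ofNat]
      simp only [sub_mul, mul_sub, mul_add, ← cc]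
      noncomm_ring
    rw [h4] at h3
    exact sub_nonneg.1 h3
  have k1 := key x hx
  have k2 := key (star x) (by rwa [star_star, add_comm])
  rw [star_star] at k2
  have hu : IsUnit x := isUnit_of_isUnit_star_mul (CStarAlgebra.isUnit_of_le _ k1 hpos)
    (CStarAlgebra.isUnit_of_le _ k2 hpos)
  refine ⟨hu, ?_⟩
  set y := Ring.inverse x with hy
  have hxy : x * y = 1 := Ring.mul_inverse_cancel x hu
  have h6 : c ^ 2 • (star y * y) ≤ 1 := by
    have h7 := star_left_conjugate_le_conjugate k1 y
    have h8 : star y * (star x * x) * y = 1 := by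
      have : star y * star x = 1 := by rw [← star_mul, hxy, star_one]
      rw [← mul_assoc, this, one_mul, hxy]
    have h9 : star y * algebraMap ℝ A (c ^ 2) * y = c ^ 2 • (star y * y) := by
      rw [← Algebra.commutes, mul_assoc, Algebra.smul_def]
    rwa [h8, h9] at h7
  have h10 : ‖c ^ 2 • (star y * y)‖ ≤ 1 :=
    (CStarAlgebra.norm_le_one_iff_of_nonneg _
      (smul_nonneg (by positivity) (star_mul_self_nonneg y))).2 h6
  rw [norm_smul, CStarRing.norm_star_mul_self, Real.norm_of_nonneg (by positivity)] at h10
  have : (c * ‖y‖) ^ 2 ≤ 1 := by nlinarith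
  exact (abs_le_one_iff_mul_self_le_one.2 (by nlinarith)) |> (le_abs_self _).trans

/-- Resolvent bounds on the positive half-line for an invertible accretive element. -/
lemma resolvent_bounds {w v : A} (h1 : w * v = 1) (h2 : v * w = 1) (hw : 0 ≤ w + star w)
    {s : ℝ} (hs : 0 ≤ s) :
    IsUnit (w + algebraMap ℝ A s) ∧ s * ‖Ring.inverse (w + algebraMap ℝ A s)‖ ≤ 1 ∧
      ‖Ring.inverse (w + algebraMap ℝ A s)‖ ≤ ‖v‖ := by
  have hstar : ∀ r : ℝ, star (algebraMap ℝ A r) = algebraMap ℝ A r := fun r => by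
    rw [← algebraMap_star_comm]; simp
  have hv : 0 ≤ v + star v := by
    have h3 := star_left_conjugate_nonneg hw v
    have h4 : star v * (w + star w) * v = v + star v := by
      have : star v * star w = 1 := by rw [← star_mul, h1, star_one]
      rw [mul_add, add_mul, this, mul_assoc, h1, mul_one, one_mul, add_comm]
    rwa [h4] at h3
  have h5 := isUnit_of_le_add_star (x := 1 + s • v) one_pos (by
    have h6 : 0 ≤ s • (v + star v) := smul_nonneg hs hv
    have h7 : (1 + s • v) + star (1 + s • v) = algebraMap ℝ A (2 * 1) + s • (v + star v) := by
      simp only [star_add, star_one, star_smul, star_trivial, smul_add, mul_one, map_ofNat]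
      rw [← one_add_one_eq_two]; abel
    rw [h7]; exact le_add_of_nonneg_right h6)
  have h8 : w + algebraMap ℝ A s = (1 + s • v) * w := by
    rw [add_mul, one_mul, smul_mul_assoc, h2, Algebra.algebraMap_eq_smul_one]
  have hwu : IsUnit w := isUnit_iff_exists.2 ⟨v, h1, h2⟩
  have hu : IsUnit (w + algebraMap ℝ A s) := by rw [h8]; exact h5.1.mul hwu
  refine ⟨hu, ?_, ?_⟩
  · rcases hs.eq_or_lt with rfl | hs'
    · simp
    refine (isUnit_of_le_add_star hs' ?_).2
    rw [star_add, hstar, two_mul, map_add]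
    have : w + algebraMap ℝ A s + (star w + algebraMap ℝ A s)
      = algebraMap ℝ A s + algebraMap ℝ A s + (w + star w) := by abel
    rw [this]; exact le_add_of_nonneg_right hw
  · have h9 : Ring.inverse (w + algebraMap ℝ A s) = v * Ring.inverse (1 + s • v) := by
      refine (left_inv_eq_right_inv (Ring.inverse_mul_cancel _ hu) ?_)
      rw [h8, mul_assoc, ← mul_assoc w, h1, one_mul, Ring.mul_inverse_cancel _ h5.1]
    rw [h9]
    calc _ ≤ ‖v‖ * ‖Ring.inverse (1 + s • v)‖ := norm_mul_le _ _
      _ ≤ ‖v‖ * 1 := by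
        gcongr; linarith [h5.2]
      _ = _ := mul_one _

end CStar

section Trace

variable {A : Type*} [CStarAlgebra A] [PartialOrder A] (φ : TracialState A)

/-- The state as a continuous linear functional. -/
def TracialState.clm : A →L[ℂ] ℂ := ⟨φ.tr, φ.cont⟩

@[simp] lemma TracialState.clm_apply (x : A) : φ.clm x = φ.tr x := rfl

lemma TracialState.norm_tr_le (x : A) : ‖φ.tr x‖ ≤ ‖φ.clm‖ * ‖x‖ := φ.clm.le_opNorm x

variable [StarOrderedRing A]

lemma TracialState.im_of_isSelfAdjoint {h : A} (hh : IsSelfAdjoint h) : (φ.tr h).im = 0 := by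
  rw [← CFC.posPart_sub_negPart h hh, map_sub, Complex.sub_im,
    (φ.state_pos _ (CFC.posPart_nonneg h)).2, (φ.state_pos _ (CFC.negPart_nonneg h)).2, sub_zero]

lemma TracialState.tr_star (x : A) : φ.tr (star x) = star (φ.tr x) := by
  have h1 := φ.im_of_isSelfAdjoint (realPart x).2
  have h2 := φ.im_of_isSelfAdjoint (imaginaryPart x).2
  have h3 : star x = (realPart x : A) - Complex.I • (imaginaryPart x : A) := by
    conv_lhs => rw [← realPart_add_I_smul_imaginaryPart x]
    rw [star_add, star_smul, (realPart x).2.star_eq, (imaginaryPart x).2.star_eq]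
    simp [sub_eq_add_neg]
  conv_rhs => rw [← realPart_add_I_smul_imaginaryPart x]
  rw [h3]
  apply Complex.ext <;> simp [h1, h2]

/-- Positivity of a self-adjoint element can be tested in the quadratic form of the state. -/
lemma TracialState.nonneg_of_form {y : A} (hy : IsSelfAdjoint y)
    (h : ∀ x : A, 0 ≤ (φ.tr (star x * y * x)).re) : 0 ≤ y := by
  have hn : (0 : A) ≤ y⁻ := CFC.negPart_nonneg y
  have hns : IsSelfAdjoint (y⁻ : A) := .of_nonneg hn
  have h0 : star (y⁻) * y * y⁻ = -(y⁻ ^ 3 : A) := by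
    rw [hns.star_eq]
    have e : (y⁻ : A) * y = y⁻ * (y⁺ - y⁻) := by rw [CFC.posPart_sub_negPart y hy]
    rw [e, mul_sub, CFC.negPart_mul_posPart]
    noncomm_ring
  have h1 := h y⁻
  rw [h0, map_neg, Complex.neg_re] at h1
  have h3 : (0 : A) ≤ y⁻ ^ 3 := CStarAlgebra.pow_nonneg hn 3
  have h4 := φ.state_pos _ h3
  have h5 : φ.tr (y⁻ ^ 3 : A) = 0 := Complex.ext (by simp; linarith) h4.2
  have h6 := φ.faithful _ h3 h5
  have h7 : (y⁻ : A) ^ 2 = 0 := by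
    rw [← CStarRing.star_mul_self_eq_zero_iff, (hns.pow 2).star_eq, ← pow_add]
    rw [pow_succ, h6, zero_mul]
  have h8 : (y⁻ : A) = 0 := by
    rw [← CStarRing.star_mul_self_eq_zero_iff, hns.star_eq, ← pow_two, h7]
  exact (CFC.negPart_eq_zero_iff y hy).1 h8

lemma TracialState.le_algebraMap_of_form {y : A} (hy : IsSelfAdjoint y) {K : ℝ}
    (h : ∀ x : A, (φ.tr (star x * y * x)).re ≤ K * (φ.tr (star x * x)).re) :
    y ≤ algebraMap ℝ A K := by
  rw [← sub_nonneg]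
  refine φ.nonneg_of_form ((IsSelfAdjoint.algebraMap A (.all K)).sub hy) fun x => ?_
  have : star x * (algebraMap ℝ A K - y) * x = (K : ℂ) • (star x * x) - star x * y * x := by
    rw [mul_sub, sub_mul, Algebra.algebraMap_eq_smul_one, mul_smul_comm, mul_one, smul_mul_assoc,
      Complex.coe_smul]
  rw [this, map_sub, map_smul]
  have := h x
  simp
  linarith

lemma TracialState.norm_le_of_form {y : A} {K : ℝ} (hK : 0 ≤ K)
    (h : ∀ x : A, ‖φ.tr (star x * y * x)‖ ≤ K * (φ.tr (star x * x)).re) : ‖y‖ ≤ 2 * K := by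
  have hsa : ∀ z : A, IsSelfAdjoint z →
      (∀ x : A, ‖φ.tr (star x * z * x)‖ ≤ K * (φ.tr (star x * x)).re) → ‖z‖ ≤ K := by
    intro z hz hb
    refine norm_le_of_isSelfAdjoint hz hK (φ.le_algebraMap_of_form hz fun x => ?_)
      (φ.le_algebraMap_of_form hz.neg fun x => ?_)
    · exact (Complex.re_le_norm _).trans (hb x)
    · refine (Complex.re_le_norm _).trans ?_
      rw [mul_neg, neg_mul, map_neg, norm_neg]
      exact hb x
  have hstar : ∀ x : A, φ.tr (star x * star y * x) = star (φ.tr (star x * y * x)) := by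
    intro x
    rw [← φ.tr_star]
    simp [mul_assoc]
  have h1 : ‖(realPart y : A)‖ ≤ K := by
    refine hsa _ (realPart y).2 fun x => ?_
    rw [realPart_apply_coe]
    rw [mul_smul_comm, smul_mul_assoc, ← Complex.coe_smul, map_smul, mul_add, add_mul, map_add,
      hstar]
    calc _ ≤ 2⁻¹ * (‖φ.tr (star x * y * x)‖ + ‖φ.tr (star x * y * x)‖) := by
          rw [norm_smul]
          gcongr
          · simp
          · refine (norm_add_le _ _).trans ?_
            rw [norm_star]
      _ ≤ _ := by linarith [h x]
  have h2 : ‖(imaginaryPart y : A)‖ ≤ K := by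
    refine hsa _ (imaginaryPart y).2 fun x => ?_
    rw [imaginaryPart_apply_coe]
    rw [mul_smul_comm, smul_mul_assoc, mul_smul_comm, smul_mul_assoc, ← Complex.coe_smul (2⁻¹ : ℝ),
      map_smul, map_smul, mul_sub, sub_mul, map_sub, hstar]
    calc _ ≤ 2⁻¹ * (‖φ.tr (star x * y * x)‖ + ‖φ.tr (star x * y * x)‖) := by
          rw [norm_smul, norm_smul]
          simp only [norm_neg, Complex.norm_I, one_mul]
          gcongr
          · simp
          · refine (norm_sub_le _ _).trans ?_
            rw [norm_star]
      _ ≤ _ := by linarith [h x]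
  rw [← realPart_add_I_smul_imaginaryPart y]
  refine (norm_add_le _ _).trans ?_
  rw [norm_smul, Complex.norm_I, one_mul]
  linarith

end Trace

lemma integrableOn_inv_add_sq {c : ℝ} (hc : 0 < c) :
    IntegrableOn (fun s : ℝ => ((c + s) ^ 2)⁻¹) (Ioi 0) ∧
      ∫ s in Ioi (0 : ℝ), ((c + s) ^ 2)⁻¹ = c⁻¹ := by
  have hd : ∀ s ∈ Ici (0 : ℝ), HasDerivAt (fun s : ℝ => -(c + s)⁻¹) (((c + s) ^ 2)⁻¹) s := by
    intro s hs
    have hs' : (0 : ℝ) ≤ s := hs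
    have h := (((hasDerivAt_id s).const_add c).inv (by simp; positivity)).neg
    refine h.congr_deriv ?_
    simp [neg_div]
  have hp : ∀ s ∈ Ioi (0 : ℝ), 0 ≤ ((c + s) ^ 2)⁻¹ := fun s _ => by positivity
  have ht : Tendsto (fun s : ℝ => -(c + s)⁻¹) atTop (𝓝 0) := by
    rw [← neg_zero]
    exact (tendsto_inv_atTop_zero.comp (tendsto_atTop_add_const_left _ _ tendsto_id)).neg
  refine ⟨integrableOn_Ioi_deriv_of_nonneg' hd hp ht, ?_⟩
  rw [integral_Ioi_of_hasDerivAt_of_nonneg' hd hp ht]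
  simp

section Resolvent

variable {A : Type*} [CStarAlgebra A]

/-- The resolvent `(w + s)⁻¹`. -/
def res (w : A) (s : ℝ) : A := Ring.inverse (w + algebraMap ℝ A s)

/-- The resolvent of `w` exists on the positive half-line and is bounded by `M / (c + s)`. -/
def ResBound (w : A) (c M : ℝ) : Prop :=
  ∀ s : ℝ, 0 ≤ s → IsUnit (w + algebraMap ℝ A s) ∧ ‖res w s‖ ≤ M * (c + s)⁻¹

lemma ResBound.of_accretive [PartialOrder A] [StarOrderedRing A] {w v : A} (h1 : w * v = 1)
    (h2 : v * w = 1) (hw : 0 ≤ w + star w) {c M : ℝ} (hc : 0 < c) (hM : c * ‖v‖ + 1 ≤ M) :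
    ResBound w c M := by
  intro s hs
  obtain ⟨h3, h4, h5⟩ := resolvent_bounds h1 h2 hw hs
  refine ⟨h3, ?_⟩
  rw [← div_eq_mul_inv, le_div_iff₀ (by positivity)]
  change ‖Ring.inverse (w + algebraMap ℝ A s)‖ * (c + s) ≤ M
  nlinarith

variable {w w₁ w₂ : A} {c M : ℝ}

lemma ResBound.res_sub_res (h₁ : ResBound w₁ c M) (h₂ : ResBound w₂ c M) {s : ℝ} (hs : 0 ≤ s) :
    res w₁ s - res w₂ s = res w₁ s * (w₂ - w₁) * res w₂ s := by
  have := Ring.inverse_sub_inverse (a := w₁ + algebraMap ℝ A s) (b := w₂ + algebraMap ℝ A s)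
    (iff_of_true (h₁ s hs).1 (h₂ s hs).1)
  rw [add_sub_add_right_eq_sub] at this
  exact this

lemma ResBound.hasDerivAt (h : ResBound w c M) {s : ℝ} (hs : 0 ≤ s) :
    HasDerivAt (res w) (-(res w s * res w s)) s := by
  obtain ⟨u, hu⟩ := (h s hs).1
  have h1 := hasFDerivAt_ringInverse (𝕜 := ℝ) u
  rw [hu] at h1
  have h2 : HasDerivAt (fun s : ℝ => w + algebraMap ℝ A s) 1 s := by
    have := ((hasDerivAt_id s).smul_const (1 : A)).const_add w
    simpa [Algebra.algebraMap_eq_smul_one] using this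
  have h3 := h1.comp_hasDerivAt s h2
  have h4 : res w s = ↑u⁻¹ := by rw [res, ← hu, Ring.inverse_unit]
  refine h3.congr_deriv ?_
  simp [h4]

lemma ResBound.continuousOn (h : ResBound w c M) : ContinuousOn (res w) (Ioi 0) :=
  fun _ hs => (h.hasDerivAt (le_of_lt hs)).continuousAt.continuousWithinAt

lemma ResBound.tendsto_zero (h : ResBound w c M) : Tendsto (res w) atTop (𝓝 0) := by
  have ht : Tendsto (fun s : ℝ => M * (c + s)⁻¹) atTop (𝓝 0) := by
    rw [← mul_zero M]
    exact (tendsto_inv_atTop_zero.comp (tendsto_atTop_add_const_left _ _ tendsto_id)).const_mul M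
  refine squeeze_zero_norm' ?_ ht
  filter_upwards [eventually_ge_atTop 0] with s hs
  exact (h s hs).2

end Resolvent

section LogPotential

variable {A : Type*} [CStarAlgebra A] [PartialOrder A] (φ : TracialState A)
  {w w₁ w₂ w₃ w₄ : A} {c M : ℝ}

lemma norm_tr_res_mul_le (h₁ : ResBound w₁ c M) (h₂ : ResBound w₂ c M)
    (x : A) {s : ℝ} (hs : 0 ≤ s) :
    ‖φ.tr (res w₁ s * x * res w₂ s)‖ ≤ ‖φ.clm‖ * M ^ 2 * ‖x‖ * ((c + s) ^ 2)⁻¹ := by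
  have e1 := (h₁ s hs).2
  have e2 := (h₂ s hs).2
  calc _ ≤ ‖φ.clm‖ * ‖res w₁ s * x * res w₂ s‖ := φ.norm_tr_le _
    _ ≤ ‖φ.clm‖ * (‖res w₁ s‖ * ‖x‖ * ‖res w₂ s‖) := by
      gcongr; exact norm_mul₃_le
    _ ≤ ‖φ.clm‖ * ((M * (c + s)⁻¹) * ‖x‖ * (M * (c + s)⁻¹)) := by
      gcongr
      exact mul_nonneg ((norm_nonneg _).trans e1) (norm_nonneg _)
    _ = _ := by rw [← inv_pow]; ring

lemma integrableOn_tr_res_mul (hc : 0 < c) (h₁ : ResBound w₁ c M) (h₂ : ResBound w₂ c M) (x : A) :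
    IntegrableOn (fun s => φ.tr (res w₁ s * x * res w₂ s)) (Ioi 0) := by
  refine Integrable.mono' ((integrableOn_inv_add_sq hc).1.const_mul (‖φ.clm‖ * M ^ 2 * ‖x‖)) ?_ ?_
  · refine ContinuousOn.aestronglyMeasurable ?_ measurableSet_Ioi
    exact φ.cont.comp_continuousOn
      ((h₁.continuousOn.mul continuousOn_const).mul h₂.continuousOn)
  · filter_upwards [ae_restrict_mem measurableSet_Ioi] with s hs
    exact norm_tr_res_mul_le φ h₁ h₂ x (le_of_lt hs)

lemma norm_integral_tr_res_mul_le (hc : 0 < c) (h₁ : ResBound w₁ c M) (h₂ : ResBound w₂ c M)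
    (x : A) :
    ‖∫ s in Ioi (0 : ℝ), φ.tr (res w₁ s * x * res w₂ s)‖ ≤ ‖φ.clm‖ * M ^ 2 * ‖x‖ * c⁻¹ := by
  rw [← (integrableOn_inv_add_sq hc).2, ← integral_const_mul]
  refine norm_integral_le_of_norm_le ((integrableOn_inv_add_sq hc).1.const_mul _) ?_
  filter_upwards [ae_restrict_mem measurableSet_Ioi] with s hs
  exact norm_tr_res_mul_le φ h₁ h₂ x (le_of_lt hs)

/-- The trace of the logarithm of an accretive element, as a regularised integral of its
resolvent along the positive half-line. -/
def trLog (w : A) : ℂ := ∫ s in Ioi (0 : ℝ), φ.tr (res 1 s - res w s)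

lemma integrableOn_tr_res_sub_res (hc : 0 < c) (h₁ : ResBound w₁ c M) (h₂ : ResBound w₂ c M) :
    IntegrableOn (fun s => φ.tr (res w₁ s - res w₂ s)) (Ioi 0) := by
  refine (integrableOn_congr_fun (fun s hs => ?_) measurableSet_Ioi).2
    (integrableOn_tr_res_mul φ hc h₁ h₂ (w₂ - w₁))
  rw [h₁.res_sub_res h₂ (le_of_lt hs)]

lemma trLog_sub_trLog (hc : 0 < c) (h₀ : ResBound (1 : A) c M) (h₁ : ResBound w₁ c M)
    (h₂ : ResBound w₂ c M) :
    trLog φ w₂ - trLog φ w₁ = ∫ s in Ioi (0 : ℝ), φ.tr (res w₁ s * (w₂ - w₁) * res w₂ s) := by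
  rw [trLog, trLog, ← integral_sub (integrableOn_tr_res_sub_res φ hc h₀ h₂)
    (integrableOn_tr_res_sub_res φ hc h₀ h₁)]
  refine setIntegral_congr_fun measurableSet_Ioi fun s hs => ?_
  rw [← h₁.res_sub_res h₂ (le_of_lt hs), ← map_sub]
  congr 1
  abel

lemma norm_trLog_sub_trLog_le (hc : 0 < c) (h₀ : ResBound (1 : A) c M) (h₁ : ResBound w₁ c M)
    (h₂ : ResBound w₂ c M) :
    ‖trLog φ w₂ - trLog φ w₁‖ ≤ ‖φ.clm‖ * M ^ 2 * ‖w₂ - w₁‖ * c⁻¹ := by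
  rw [trLog_sub_trLog φ hc h₀ h₁ h₂]
  exact norm_integral_tr_res_mul_le φ hc h₁ h₂ _

lemma integral_tr_res_mul_self (hc : 0 < c) (h : ResBound w c M) (x : A) :
    ∫ s in Ioi (0 : ℝ), φ.tr (res w s * x * res w s) = φ.tr (x * res w 0) := by
  have e : ∀ s, φ.tr (res w s * x * res w s) = φ.tr (x * (res w s * res w s)) := fun s => by
    rw [mul_assoc, φ.tracial, mul_assoc]
  have hd : ∀ s ∈ Ici (0 : ℝ), HasDerivAt (fun s => -φ.clm (x * res w s))
      (φ.tr (res w s * x * res w s)) s := by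
    intro s hs
    have := ((φ.clm.restrictScalars ℝ).hasFDerivAt.comp_hasDerivAt s
      ((h.hasDerivAt hs).const_mul x)).neg
    refine this.congr_deriv ?_
    simp [e]
  have ht : Tendsto (fun s => -φ.clm (x * res w s)) atTop (𝓝 0) := by
    have := ((φ.clm.continuous.tendsto _).comp (h.tendsto_zero.const_mul x)).neg
    simpa using this
  rw [integral_Ioi_of_hasDerivAt_of_tendsto' hd (integrableOn_tr_res_mul φ hc h h x) ht]
  simp

/-- The differential of `trLog` at `w₁` is `x ↦ ⟨x w₁⁻¹⟩`, with a quadratic error bound. -/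
lemma norm_trLog_sub_trLog_sub_le (hc : 0 < c) (h₀ : ResBound (1 : A) c M) (h₁ : ResBound w₁ c M)
    (h₂ : ResBound w₂ c M) :
    ‖trLog φ w₂ - trLog φ w₁ - φ.tr ((w₂ - w₁) * res w₁ 0)‖ ≤
      ‖φ.clm‖ * M ^ 3 * (c⁻¹) ^ 2 * ‖w₂ - w₁‖ ^ 2 := by
  rw [trLog_sub_trLog φ hc h₀ h₁ h₂, ← integral_tr_res_mul_self φ hc h₁,
    ← integral_sub (integrableOn_tr_res_mul φ hc h₁ h₂ _) (integrableOn_tr_res_mul φ hc h₁ h₁ _)]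
  have hM : 0 ≤ M := by
    have := (norm_nonneg _).trans (h₁ 0 le_rfl).2
    rw [add_zero] at this
    exact nonneg_of_mul_nonneg_left this (inv_pos.2 hc)
  set x := w₂ - w₁
  have hb : ∀ s ∈ Ioi (0 : ℝ), ‖φ.tr (res w₁ s * x * res w₂ s) - φ.tr (res w₁ s * x * res w₁ s)‖ ≤
      ‖φ.clm‖ * M ^ 3 * c⁻¹ * ‖x‖ ^ 2 * ((c + s) ^ 2)⁻¹ := by
    intro s hs
    have hs' : (0 : ℝ) < s := hs
    have e0 : φ.tr (res w₁ s * x * res w₂ s) - φ.tr (res w₁ s * x * res w₁ s)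
        = -φ.tr (res w₁ s * (x * res w₁ s * x) * res w₂ s) := by
      rw [← map_sub, ← mul_sub, ← neg_sub (res w₁ s), h₁.res_sub_res h₂ hs'.le, ← map_neg]
      congr 1
      simp only [x]
      noncomm_ring
    rw [e0, norm_neg]
    refine (norm_tr_res_mul_le φ h₁ h₂ _ hs'.le).trans ?_
    have e1 : ‖res w₁ s‖ ≤ M * c⁻¹ := (h₁ s hs'.le).2.trans (by gcongr; linarith)
    have e2 : ‖x * res w₁ s * x‖ ≤ M * c⁻¹ * ‖x‖ ^ 2 := by
      refine norm_mul₃_le.trans ?_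
      calc _ ≤ ‖x‖ * (M * c⁻¹) * ‖x‖ := by gcongr
        _ = _ := by ring
    calc _ ≤ ‖φ.clm‖ * M ^ 2 * (M * c⁻¹ * ‖x‖ ^ 2) * ((c + s) ^ 2)⁻¹ := by gcongr
      _ = _ := by ring
  have h3 := norm_integral_le_of_norm_le ((integrableOn_inv_add_sq hc).1.const_mul
    (‖φ.clm‖ * M ^ 3 * c⁻¹ * ‖x‖ ^ 2))
    ((ae_restrict_mem measurableSet_Ioi).mono fun s hs => hb s hs)
  refine h3.trans (le_of_eq ?_)
  rw [integral_const_mul, (integrableOn_inv_add_sq hc).2]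
  ring

end LogPotential

lemma exists_gap_of_notMem_measSupp {μ : Measure ℝ} {τ : ℝ} (hτ : τ ∉ measSupp μ) :
    ∃ ε : ℝ, 0 < ε ∧ μ (Ioo (τ - ε) (τ + ε)) = 0 := by
  simpa [measSupp] using hτ

lemma norm_inv_ofReal_sub_le {t η c : ℝ} {z : ℂ} (hc : 0 < c) (hz : z.im = η)
    (h : c ≤ |η| ∨ c ≤ |t - z.re|) : ‖((t : ℂ) - z)⁻¹‖ ≤ c⁻¹ := by
  rw [norm_inv]
  refine inv_anti₀ hc ?_
  rcases h with h | h
  · refine h.trans ?_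
    have := Complex.abs_im_le_norm ((t : ℂ) - z)
    simpa [hz] using this
  · refine h.trans ?_
    have := Complex.abs_re_le_norm ((t : ℂ) - z)
    simpa using this

lemma integrable_stieltjes {μ : Measure ℝ} [IsFiniteMeasure μ] {z : ℂ} (hz : 0 < z.im) :
    Integrable (fun t : ℝ => ((t : ℂ) - z)⁻¹) μ := by
  refine Integrable.of_bound (C := z.im⁻¹) ?_ (.of_forall fun t => ?_)
  · refine Continuous.aestronglyMeasurable ?_
    refine (Complex.continuous_ofReal.sub continuous_const).inv₀ fun t h => ?_
    have := congrArg Complex.im h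
    simp at this
    exact hz.ne' this
  · exact norm_inv_ofReal_sub_le hz rfl (.inl (le_abs_self _))

section Measure

variable {A : Type*} [CStarAlgebra A] [PartialOrder A] {φ : TracialState A} {v : OpMeasure A φ}
  {m : ℂ → A}

lemma scalar_eq_zero_of_dos_eq_zero {B : Set ℝ} (hB : MeasurableSet B) (h : v.dos B = 0) (x : A) :
    v.scalar x B = 0 := by
  have h1 := v.compat 1 B hB
  have h2 : v.scalar 1 B = 0 := h
  rw [h2] at h1
  have h3 : v.val B = 0 := φ.faithful _ (v.nonneg B) (by simpa using h1)
  have h4 := v.compat x B hB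
  rw [h3] at h4
  have : IsFiniteMeasure (v.scalar x) := v.scalarFin x
  simp only [mul_zero, zero_mul, map_zero] at h4
  have h5 : (v.scalar x B).toReal = 0 := by exact_mod_cast h4.symm
  exact ((ENNReal.toReal_eq_zero_iff _).1 h5).resolve_right (measure_ne_top _ _)

lemma scalar_univ (hv : v.val univ = 1) (x : A) :
    (v.scalar x).real univ = (φ.tr (star x * x)).re := by
  have := v.compat x univ MeasurableSet.univ
  rw [hv, mul_one] at this
  rw [this]; rfl

lemma isProbabilityMeasure_dos (hv : v.val univ = 1) : IsProbabilityMeasure v.dos := by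
  have : IsFiniteMeasure (v.scalar 1) := v.scalarFin 1
  have h := scalar_univ hv (1 : A)
  rw [star_one, mul_one, φ.unital, Complex.one_re] at h
  exact isProbabilityMeasure_iff_real.2 h

lemma ae_gap {τ ε : ℝ} (h : v.dos (Ioo (τ - ε) (τ + ε)) = 0) (x : A) :
    ∀ᵐ t ∂v.scalar x, ε ≤ |t - τ| := by
  have := scalar_eq_zero_of_dos_eq_zero measurableSet_Ioo h x
  refine measure_mono_null (fun t ht => ?_) this
  have h2 : |t - τ| < ε := not_le.1 ht
  rw [abs_lt] at h2
  exact ⟨by linarith, by linarith⟩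

lemma norm_integral_scalar_le (hv : v.val univ = 1) (x : A) {f : ℝ → ℂ} {K : ℝ}
    (h : ∀ᵐ t ∂v.scalar x, ‖f t‖ ≤ K) :
    ‖∫ t, f t ∂v.scalar x‖ ≤ K * (φ.tr (star x * x)).re := by
  have : IsFiniteMeasure (v.scalar x) := v.scalarFin x
  rw [← scalar_univ hv x]
  exact norm_integral_le_of_norm_le_const h

variable [StarOrderedRing A]

lemma norm_stieltjes_le (hv : v.val univ = 1) (hrep : StieltjesRep φ v m) {z : ℂ} (hz : 0 < z.im) :
    ‖m z‖ ≤ 2 * z.im⁻¹ := by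
  refine φ.norm_le_of_form (inv_nonneg.2 hz.le) fun x => ?_
  rw [hrep z hz x]
  exact norm_integral_scalar_le hv x
    (.of_forall fun t => norm_inv_ofReal_sub_le hz rfl (.inl (le_abs_self _)))

lemma norm_stieltjes_sub_le (hv : v.val univ = 1) (hrep : StieltjesRep φ v m) {τ ε : ℝ}
    (hε : 0 < ε) (hgap : v.dos (Ioo (τ - ε) (τ + ε)) = 0) {z₁ z₂ : ℂ} (h₁ : 0 < z₁.im)
    (h₂ : 0 < z₂.im) (hr₁ : z₁.re = τ) (hr₂ : z₂.re = τ) :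
    ‖m z₁ - m z₂‖ ≤ 2 * (ε⁻¹ ^ 2 * ‖z₁ - z₂‖) := by
  refine φ.norm_le_of_form (by positivity) fun x => ?_
  have : IsFiniteMeasure (v.scalar x) := v.scalarFin x
  rw [mul_sub, sub_mul, map_sub, hrep z₁ h₁ x, hrep z₂ h₂ x,
    ← integral_sub (integrable_stieltjes h₁) (integrable_stieltjes h₂)]
  refine norm_integral_scalar_le hv x ?_
  filter_upwards [ae_gap hgap x] with t ht
  have ne : ∀ z : ℂ, 0 < z.im → (t : ℂ) - z ≠ 0 := fun z hz h => by
    have := congrArg Complex.im h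
    simp at this
    exact hz.ne' this
  have e : ((t : ℂ) - z₁)⁻¹ - ((t : ℂ) - z₂)⁻¹ = ((t : ℂ) - z₁)⁻¹ * ((t : ℂ) - z₂)⁻¹ * (z₁ - z₂) := by
    have n1 := ne z₁ h₁
    have n2 := ne z₂ h₂
    field_simp
    ring
  rw [e, norm_mul, norm_mul, sq]
  gcongr
  · exact norm_inv_ofReal_sub_le hε rfl (.inr (by rwa [hr₁]))
  · exact norm_inv_ofReal_sub_le hε rfl (.inr (by rwa [hr₂]))

lemma norm_stieltjes_sub_star_le (hv : v.val univ = 1) (hrep : StieltjesRep φ v m) {τ ε : ℝ}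
    (hε : 0 < ε) (hgap : v.dos (Ioo (τ - ε) (τ + ε)) = 0) {z : ℂ} (hz : 0 < z.im)
    (hr : z.re = τ) :
    ‖m z - star (m z)‖ ≤ 2 * (ε⁻¹ ^ 2 * (2 * z.im)) := by
  refine φ.norm_le_of_form (by positivity) fun x => ?_
  have : IsFiniteMeasure (v.scalar x) := v.scalarFin x
  have hstar : φ.tr (star x * star (m z) * x) = star (φ.tr (star x * m z * x)) := by
    rw [← φ.tr_star]
    simp [mul_assoc]
  have hi := integrable_stieltjes (μ := v.scalar x) hz
  have hi' : Integrable (fun t : ℝ => star (((t : ℂ) - z)⁻¹)) (v.scalar x) :=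
    (Complex.conjCLE : ℂ →L[ℝ] ℂ).integrable_comp hi
  have hc : star (∫ t : ℝ, ((t : ℂ) - z)⁻¹ ∂v.scalar x)
      = ∫ t : ℝ, star (((t : ℂ) - z)⁻¹) ∂v.scalar x := integral_conj.symm
  rw [mul_sub, sub_mul, map_sub, hstar, hrep z hz x, hc, ← integral_sub hi hi']
  refine norm_integral_scalar_le hv x ?_
  filter_upwards [ae_gap hgap x] with t ht
  have e0 : (t : ℂ) - z ≠ 0 := fun h => by
    have := congrArg Complex.im h
    simp at this
    exact hz.ne' this
  have e1 : star ((t : ℂ) - z) ≠ 0 := fun h => e0 (star_eq_zero.1 h)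
  have e2 : star ((t : ℂ) - z) - ((t : ℂ) - z) = (2 * z.im : ℝ) * Complex.I := by
    apply Complex.ext <;> simp
    ring
  have e : ((t : ℂ) - z)⁻¹ - star (((t : ℂ) - z)⁻¹)
      = ((t : ℂ) - z)⁻¹ * star (((t : ℂ) - z)⁻¹) * ((2 * z.im : ℝ) * Complex.I) := by
    rw [← e2, star_inv₀]
    field_simp
  have e3 := norm_inv_ofReal_sub_le (t := t) (z := z) hε rfl (.inr (by rwa [hr]))
  rw [e, norm_mul, norm_mul, norm_star, sq]
  gcongr
  rw [norm_mul, Complex.norm_I, mul_one, Complex.norm_real, Real.norm_of_nonneg (by positivity)]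

/-- The boundary extension of `η ↦ m(τ + iη)` to `η = 0` across a gap of the density of states. -/
lemma exists_lipschitz_extension (hv : v.val univ = 1) (hrep : StieltjesRep φ v m) {τ ε : ℝ}
    (hε : 0 < ε) (hgap : v.dos (Ioo (τ - ε) (τ + ε)) = 0) :
    ∃ M : ℝ → A, (∀ η : ℝ, 0 < η → M η = m ((τ : ℂ) + (η : ℂ) * Complex.I)) ∧
      IsSelfAdjoint (M 0) ∧
      ∀ η₁ η₂ : ℝ, 0 ≤ η₁ → 0 ≤ η₂ → ‖M η₁ - M η₂‖ ≤ 2 * ε⁻¹ ^ 2 * |η₁ - η₂| := by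
  set N : ℝ → A := fun η => m ((τ : ℂ) + (η : ℂ) * Complex.I)
  have hN : ∀ η₁ η₂ : ℝ, 0 < η₁ → 0 < η₂ → ‖N η₁ - N η₂‖ ≤ 2 * ε⁻¹ ^ 2 * |η₁ - η₂| := by
    intro η₁ η₂ h₁ h₂
    refine (norm_stieltjes_sub_le hv hrep hε hgap (by simpa) (by simpa) (by simp)
      (by simp)).trans (le_of_eq ?_)
    have : ((τ : ℂ) + (η₁ : ℂ) * Complex.I) - ((τ : ℂ) + (η₂ : ℂ) * Complex.I)
        = ((η₁ - η₂ : ℝ) : ℂ) * Complex.I := by push_cast; ring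
    rw [this, norm_mul, Complex.norm_I, mul_one, Complex.norm_real, Real.norm_eq_abs]
    ring
  have hlip : LipschitzOnWith (2 * ε⁻¹ ^ 2).toNNReal N (Ioi 0) := by
    refine LipschitzOnWith.of_dist_le_mul fun η₁ h₁ η₂ h₂ => ?_
    rw [dist_eq_norm, Real.dist_eq, Real.coe_toNNReal _ (by positivity)]
    exact hN η₁ η₂ h₁ h₂
  have hcau : Cauchy (map N (𝓝[>] 0)) :=
    Cauchy.map_of_le (cauchy_nhds.mono nhdsWithin_le_nhds) hlip.uniformContinuousOn inf_le_right
  obtain ⟨l, hl⟩ := CompleteSpace.complete hcau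
  have hl' : Tendsto N (𝓝[>] 0) (𝓝 l) := hl
  have hpos : ∀ᶠ η : ℝ in 𝓝[>] 0, 0 < η := eventually_mem_nhdsWithin
  have hN0 : ∀ η : ℝ, 0 < η → ‖N η - l‖ ≤ 2 * ε⁻¹ ^ 2 * |η| := by
    intro η hη
    have t1 : Tendsto (fun η' => ‖N η - N η'‖) (𝓝[>] 0) (𝓝 ‖N η - l‖) :=
      (tendsto_const_nhds.sub hl').norm
    have t2 : Tendsto (fun η' : ℝ => 2 * ε⁻¹ ^ 2 * |η - η'|) (𝓝[>] 0)
        (𝓝 (2 * ε⁻¹ ^ 2 * |η - 0|)) :=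
      (Continuous.tendsto (by fun_prop) 0).mono_left nhdsWithin_le_nhds
    rw [sub_zero] at t2
    exact le_of_tendsto_of_tendsto t1 t2 (hpos.mono fun η' h' => hN η η' hη h')
  have hsa : IsSelfAdjoint l := by
    have t1 : Tendsto (fun η' => ‖N η' - star (N η')‖) (𝓝[>] 0) (𝓝 ‖l - star l‖) :=
      (hl'.sub hl'.star).norm
    have t2 : Tendsto (fun η' : ℝ => 2 * (ε⁻¹ ^ 2 * (2 * η'))) (𝓝[>] 0)
        (𝓝 (2 * (ε⁻¹ ^ 2 * (2 * 0)))) :=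
      (Continuous.tendsto (by fun_prop) 0).mono_left nhdsWithin_le_nhds
    have h3 := le_of_tendsto_of_tendsto t1 t2 (hpos.mono fun η' h' => by
      simpa using norm_stieltjes_sub_star_le hv hrep hε hgap
        (z := (τ : ℂ) + (η' : ℂ) * Complex.I) (by simpa) (by simp))
    simp only [mul_zero] at h3
    exact (sub_eq_zero.1 (norm_le_zero_iff.1 h3)).symm
  refine ⟨fun η => if 0 < η then N η else l, fun η hη => if_pos hη, by simpa using hsa, ?_⟩
  intro η₁ η₂ h₁ h₂
  rcases h₁.eq_or_lt with rfl | h₁' <;> rcases h₂.eq_or_lt with rfl | h₂'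
  · simp
  · simp only [lt_self_iff_false, if_false, h₂', if_true, zero_sub, abs_neg]
    rw [norm_sub_rev]
    exact hN0 _ h₂'
  · simp only [lt_self_iff_false, if_false, h₁', if_true, sub_zero]
    exact hN0 _ h₁'
  · simp only [h₁', h₂', if_true]
    exact hN _ _ h₁' h₂'

end Measure

lemma res_zero {A : Type*} [CStarAlgebra A] {w v : A} (h1 : w * v = 1) (h2 : v * w = 1) : res w 0 = v := by
  rw [res, map_zero, add_zero]
  exact Ring.inverse_unit ⟨w, v, h1, h2⟩

section Flow

variable {A : Type*} [CStarAlgebra A] [PartialOrder A]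

/-- The Dyson equation along a vertical line, in the coordinates `w = -i m`. -/
structure IsFlow (b : A) (S : A →L[ℂ] A) (w : ℝ → A) (L : ℝ) : Prop where
  mul_eq_one : ∀ η, 0 ≤ η → w η * (algebraMap ℝ A η + b + S (w η)) = 1
  eq_mul_one : ∀ η, 0 ≤ η → (algebraMap ℝ A η + b + S (w η)) * w η = 1
  accretive : ∀ η, 0 ≤ η → 0 ≤ w η + star (w η)
  lipschitz : ∀ η₁ η₂, 0 ≤ η₁ → 0 ≤ η₂ → ‖w η₁ - w η₂‖ ≤ L * |η₁ - η₂|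

/-- The free energy functional of the Dyson equation. -/
def freeEnergy (φ : TracialState A) (b : A) (S : A →L[ℂ] A) (w : A) (η : ℝ) : ℂ :=
  trLog φ w - ((η : ℂ) * φ.tr w + φ.tr (b * w) + (1 / 2) * φ.tr (w * S w))

lemma freeEnergy_sub (φ : TracialState A) {b : A} {S : A →L[ℂ] A}
    (hS : ∀ x y, φ.tr (S x * y) = φ.tr (x * S y)) (w₁ w₂ : A) (η₁ η₂ : ℝ) :
    freeEnergy φ b S w₂ η₂ - freeEnergy φ b S w₁ η₁ + ((η₂ : ℂ) - η₁) * φ.tr w₁ =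
      (trLog φ w₂ - trLog φ w₁ - φ.tr ((w₂ - w₁) * (algebraMap ℝ A η₁ + b + S w₁)))
        - (((η₂ : ℂ) - η₁) * φ.tr (w₂ - w₁) + (1 / 2) * φ.tr ((w₂ - w₁) * S (w₂ - w₁))) := by
  have h1 : φ.tr (w₁ * S w₂) = φ.tr (w₂ * S w₁) := by rw [← hS, φ.tracial]
  have h2 : φ.tr (w₁ * b) = φ.tr (b * w₁) := φ.tracial _ _
  have h3 : φ.tr (w₂ * b) = φ.tr (b * w₂) := φ.tracial _ _
  have h4 : ∀ x : A, φ.tr (x * algebraMap ℝ A η₁) = (η₁ : ℂ) * φ.tr x := fun x => by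
    rw [Algebra.algebraMap_eq_smul_one, mul_smul_comm, mul_one, ← Complex.coe_smul, map_smul,
      smul_eq_mul]
  simp only [freeEnergy, mul_add, sub_mul, mul_sub, map_add, map_sub, h1, h2, h3, h4]
  ring

variable {b : A} {S : A →L[ℂ] A} {w : ℝ → A} {L : ℝ}

lemma IsFlow.nonneg (h : IsFlow b S w L) : 0 ≤ L := by
  have := h.lipschitz 1 0 zero_le_one le_rfl
  exact (norm_nonneg _).trans (by simpa using this)

variable [StarOrderedRing A]

lemma resBound_one {M : ℝ} (hM : ‖(1 : A)‖ + 1 ≤ M) : ResBound (1 : A) 1 M :=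
  ResBound.of_accretive (v := 1) (mul_one 1) (mul_one 1)
    (by rw [star_one]; exact add_nonneg zero_le_one zero_le_one) one_pos (by simpa using hM)

lemma IsFlow.exists_resBound (h : IsFlow b S w L) {η₀ : ℝ} (h₀ : 0 ≤ η₀) :
    ∃ M : ℝ, ResBound (1 : A) 1 M ∧ ∀ η, 0 ≤ η → |η - η₀| ≤ 1 → ResBound (w η) 1 M := by
  set K : ℝ := (η₀ + 1) * ‖(1 : A)‖ + ‖b‖ + ‖S‖ * (L + ‖w η₀‖)
  refine ⟨max (‖(1 : A)‖ + 1) (K + 1), resBound_one (le_max_left _ _), fun η hη hd => ?_⟩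
  refine ResBound.of_accretive (h.mul_eq_one η hη) (h.eq_mul_one η hη) (h.accretive η hη) one_pos
    (le_trans ?_ (le_max_right _ _))
  have h1 : ‖w η‖ ≤ L + ‖w η₀‖ := by
    have := h.lipschitz η η₀ hη h₀
    have h2 : ‖w η‖ ≤ ‖w η - w η₀‖ + ‖w η₀‖ := by
      simpa using norm_add_le (w η - w η₀) (w η₀)
    nlinarith [h.nonneg]
  have h3 : ‖algebraMap ℝ A η‖ ≤ (η₀ + 1) * ‖(1 : A)‖ := by
    rw [norm_algebraMap, Real.norm_eq_abs, abs_of_nonneg hη]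
    gcongr
    linarith [(abs_le.1 hd).2]
  have h4 : ‖S (w η)‖ ≤ ‖S‖ * (L + ‖w η₀‖) :=
    (S.le_opNorm _).trans (by gcongr)
  have := norm_add₃_le (a := algebraMap ℝ A η) (b := b) (c := S (w η))
  rw [one_mul]
  simp only [K]
  linarith

/-- The free energy is differentiable up to the boundary along the flow; by stationarity only
the explicit dependence on `η` contributes. -/
lemma IsFlow.hasDerivWithinAt (h : IsFlow b S w L) (φ : TracialState A)
    (hS : ∀ x y, φ.tr (S x * y) = φ.tr (x * S y)) {η : ℝ} (hη : 0 ≤ η) :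
    HasDerivWithinAt (fun η => freeEnergy φ b S (w η) η) (-φ.tr (w η)) (Ici 0) η := by
  obtain ⟨M, hM₀, hM⟩ := h.exists_resBound hη
  have hL := h.nonneg
  have hM0 : 0 ≤ M := by
    have := (norm_nonneg _).trans (hM₀ 0 le_rfl).2
    simpa using this
  set K : ℝ := ‖φ.clm‖ * M ^ 3 * L ^ 2 + ‖φ.clm‖ * L + ‖φ.clm‖ * (‖S‖ * L ^ 2)
  have key : ∀ y, 0 ≤ y → |y - η| ≤ 1 →
      ‖freeEnergy φ b S (w y) y - freeEnergy φ b S (w η) η - (y - η) • (-φ.tr (w η))‖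
        ≤ K * |y - η| ^ 2 := by
    intro y hy hd
    have e : freeEnergy φ b S (w y) y - freeEnergy φ b S (w η) η - (y - η) • (-φ.tr (w η)) =
        freeEnergy φ b S (w y) y - freeEnergy φ b S (w η) η + ((y : ℂ) - η) * φ.tr (w η) := by
      rw [Complex.real_smul]; push_cast; ring
    rw [e, freeEnergy_sub φ hS]
    have hl := h.lipschitz y η hy hη
    have h1 := norm_trLog_sub_trLog_sub_le φ one_pos hM₀ (hM η hη (by simp)) (hM y hy hd)
    rw [res_zero (h.mul_eq_one η hη) (h.eq_mul_one η hη)] at h1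
    have h1' : ‖φ.clm‖ * M ^ 3 * (1 : ℝ)⁻¹ ^ 2 * ‖w y - w η‖ ^ 2
        ≤ ‖φ.clm‖ * M ^ 3 * L ^ 2 * |y - η| ^ 2 := by
      rw [inv_one, one_pow, mul_one, mul_assoc _ (L ^ 2), ← mul_pow]
      gcongr
    have h2 : ‖((y : ℂ) - η) * φ.tr (w y - w η)‖ ≤ ‖φ.clm‖ * L * |y - η| ^ 2 := by
      rw [norm_mul, ← Complex.ofReal_sub, Complex.norm_real, Real.norm_eq_abs]
      calc _ ≤ |y - η| * (‖φ.clm‖ * (L * |y - η|)) := by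
            gcongr; exact (φ.norm_tr_le _).trans (by gcongr)
        _ = _ := by ring
    have h3 : ‖(1 / 2 : ℂ) * φ.tr ((w y - w η) * S (w y - w η))‖
        ≤ ‖φ.clm‖ * (‖S‖ * L ^ 2) * |y - η| ^ 2 := by
      rw [norm_mul]
      have h5 : ‖(1 / 2 : ℂ)‖ ≤ 1 := by norm_num
      have h6 : ‖φ.tr ((w y - w η) * S (w y - w η))‖ ≤
          ‖φ.clm‖ * ((L * |y - η|) * (‖S‖ * (L * |y - η|))) := by
        refine (φ.norm_tr_le _).trans ?_
        gcongr
        refine (norm_mul_le _ _).trans ?_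
        gcongr
        exact (S.le_opNorm _).trans (by gcongr)
      calc _ ≤ 1 * (‖φ.clm‖ * ((L * |y - η|) * (‖S‖ * (L * |y - η|)))) := by gcongr
        _ = _ := by ring
    calc _ ≤ _ := (norm_sub_le _ _).trans (add_le_add_right (norm_add_le _ _) _)
      _ ≤ K * |y - η| ^ 2 := by simp only [K]; linarith
  rw [hasDerivWithinAt_iff_isLittleO]
  have hO : (fun y => freeEnergy φ b S (w y) y - freeEnergy φ b S (w η) η
      - (y - η) • (-φ.tr (w η))) =O[𝓝[Ici 0] η] fun y => (y - η) ^ 2 := by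
    refine Asymptotics.IsBigO.of_bound K ?_
    have : ∀ᶠ y in 𝓝[Ici 0] η, |y - η| ≤ 1 := by
      refine nhdsWithin_le_nhds ?_
      filter_upwards [Metric.closedBall_mem_nhds η one_pos] with y hy
      simpa [Real.dist_eq] using hy
    filter_upwards [this, self_mem_nhdsWithin] with y h1 h2
    simpa using key y h2 h1
  refine hO.trans_isLittleO ?_
  have h7 : Tendsto (fun y : ℝ => y - η) (𝓝[Ici 0] η) (𝓝 0) := by
    have : ContinuousAt (fun y : ℝ => y - η) η := by fun_prop
    have h8 := this.tendsto
    rw [sub_self] at h8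
    exact h8.mono_left nhdsWithin_le_nhds
  simpa [pow_two] using ((Asymptotics.isLittleO_one_iff ℝ).2 h7).mul_isBigO
    (Asymptotics.isBigO_refl (fun y : ℝ => y - η) _)

end Flow

lemma integral_Ioi_div_sq_add_sq {t : ℝ} (ht : 0 < t) :
    ∫ s in Ioi (0 : ℝ), t / (s ^ 2 + t ^ 2) = Real.pi / 2 := by
  have hd : ∀ s ∈ Ici (0 : ℝ), HasDerivAt (fun s => Real.arctan (s / t)) (t / (s ^ 2 + t ^ 2)) s := by
    intro s _
    have h := (Real.hasDerivAt_arctan (s / t)).comp s ((hasDerivAt_id s).div_const t)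
    refine h.congr_deriv ?_
    field_simp
    ring
  have hlim : Tendsto (fun s : ℝ => Real.arctan (s / t)) atTop (𝓝 (Real.pi / 2)) :=
    (tendsto_nhds_of_tendsto_nhdsWithin Real.tendsto_arctan_atTop).comp
      (tendsto_id.atTop_div_const ht)
  rw [integral_Ioi_of_hasDerivAt_of_nonneg' hd (fun s _ => by positivity) hlim]
  simp

section Boundary

variable {A : Type*} [CStarAlgebra A] [PartialOrder A]

lemma exists_forall_mem_spectrum_le_abs {A : Type*} [CStarAlgebra A] {x y : A}
    (hxy : x * y = 1) (hyx : y * x = 1) : ∃ δ : ℝ, 0 < δ ∧ ∀ t ∈ spectrum ℝ x, δ ≤ |t| := by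
  have h0 : (0 : ℝ) ∉ spectrum ℝ x :=
    (spectrum.zero_notMem_iff ℝ).2 ⟨⟨x, y, hxy, hyx⟩, rfl⟩
  have ho : IsOpen (spectrum ℝ x)ᶜ := (spectrum.isCompact (𝕜 := ℝ) x).isClosed.isOpen_compl
  obtain ⟨δ, hδ, hb⟩ := Metric.isOpen_iff.1 ho 0 h0
  refine ⟨δ, hδ, fun t ht => not_lt.1 fun h => hb ?_ ht⟩
  simpa [Real.dist_eq] using h

lemma res_neg_I_smul {A : Type*} [CStarAlgebra A] {x : A} (hx : IsSelfAdjoint x) {s : ℝ}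
    (hs : 0 < s) :
    res (-Complex.I • x) s = s • cfc (fun t : ℝ => (s ^ 2 + t ^ 2)⁻¹) x
      + Complex.I • cfc (fun t : ℝ => t / (s ^ 2 + t ^ 2)) x := by
  have hne : ∀ t : ℝ, s ^ 2 + t ^ 2 ≠ 0 := fun t => by positivity
  have hc : Continuous fun t : ℝ => (s ^ 2 + t ^ 2)⁻¹ := by
    refine Continuous.inv₀ (by fun_prop) hne
  set R : A := cfc (fun t : ℝ => (s ^ 2 + t ^ 2)⁻¹) x with hR
  have hxR : x * R = cfc (fun t : ℝ => t / (s ^ 2 + t ^ 2)) x := by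
    conv_lhs => enter [1]; rw [← cfc_id' ℝ x]
    rw [← cfc_mul _ _ x (by fun_prop) hc.continuousOn]
    rfl
  have hRx : R * x = cfc (fun t : ℝ => t / (s ^ 2 + t ^ 2)) x := by
    conv_lhs => enter [2]; rw [← cfc_id' ℝ x]
    rw [← cfc_mul _ _ x hc.continuousOn (by fun_prop)]
    exact cfc_congr fun t _ => by simp [div_eq_mul_inv, mul_comm]
  have hcomm : R * x = x * R := hRx.trans hxR.symm
  have h1 : (s ^ 2) • R + x * (x * R) = 1 := by
    rw [hxR]
    conv_lhs => enter [2, 1]; rw [← cfc_id' ℝ x]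
    have hc2 : Continuous fun t : ℝ => t / (s ^ 2 + t ^ 2) :=
      Continuous.div (by fun_prop) (by fun_prop) hne
    rw [← cfc_mul _ _ x (by fun_prop) hc2.continuousOn, hR, ← cfc_smul _ _ x hc.continuousOn,
      ← cfc_add (a := x) (fun t => s ^ 2 • (s ^ 2 + t ^ 2)⁻¹) (fun t => t * (t / (s ^ 2 + t ^ 2)))
        (hc.const_smul (s ^ 2)).continuousOn (continuous_id'.mul hc2).continuousOn,
      ← cfc_one ℝ x]
    refine cfc_congr fun t _ => ?_
    have := hne t
    simp only [smul_eq_mul, Pi.one_apply]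
    field_simp
  rw [← hxR]
  rw [res]
  refine Ring.inverse_unit ⟨_, s • R + Complex.I • (x * R), ?_, ?_⟩
  · rw [← h1, Algebra.algebraMap_eq_smul_one]
    simp only [mul_add, add_mul, smul_mul_assoc, mul_smul_comm, one_mul, ← Complex.coe_smul]
    match_scalars
    · ring
    · ring
    · simp
  · rw [← h1, Algebra.algebraMap_eq_smul_one]
    simp only [mul_add, add_mul, smul_mul_assoc, mul_smul_comm, mul_one, ← Complex.coe_smul,
      mul_assoc, hcomm]
    match_scalars
    · ring
    · simp
    · ring

variable [StarOrderedRing A] (φ : TracialState A)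

lemma im_trLog_neg_I_smul {x y : A} (hx : IsSelfAdjoint x) (hxy : x * y = 1) (hyx : y * x = 1)
    {g : ℝ → ℝ} (hg : Continuous g) (hneg : ∀ t ∈ spectrum ℝ x, t < 0 → g t = 1)
    (hpos : ∀ t ∈ spectrum ℝ x, 0 ≤ t → g t = 0) :
    (trLog φ (-Complex.I • x)).im = -(Real.pi / 2 * (1 - 2 * (φ.tr (cfc g x)).re)) := by
  obtain ⟨δ, hδ, hspec⟩ := exists_forall_mem_spectrum_le_abs hxy hyx
  have hbd : ResBound (-Complex.I • x) 1 (max (‖(1 : A)‖ + 1) (1 * ‖Complex.I • y‖ + 1)) := by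
    refine ResBound.of_accretive (v := Complex.I • y) ?_ ?_ ?_ one_pos (le_max_right _ _)
    · simp [smul_smul, hxy]
    · simp [smul_smul, hyx]
    · simp [hx.star_eq]
  have hdiff := integrableOn_tr_res_sub_res φ one_pos (resBound_one (le_max_left _ _)) hbd
  have him : ∀ s ∈ Ioi (0 : ℝ), (φ.tr (res 1 s - res (-Complex.I • x) s)).im =
      -(φ.clm (cfc (fun t : ℝ => t / (s ^ 2 + t ^ 2)) x)).re := by
    intro s hs
    have h1 : (1 : A) + algebraMap ℝ A s = algebraMap ℝ A (1 + s) := by simp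
    have h2 : IsSelfAdjoint (res (1 : A) s) := by
      rw [res, h1]
      exact (IsSelfAdjoint.algebraMap A (.all (1 + s))).ringInverse
    have h3 := φ.im_of_isSelfAdjoint
      (h := cfc (fun t : ℝ => (s ^ 2 + t ^ 2)⁻¹) x) (cfc_predicate _ x)
    have h4 := φ.im_of_isSelfAdjoint h2
    rw [res_neg_I_smul hx hs, ← Complex.coe_smul]
    simp [h3, h4]
  obtain ⟨K, hK⟩ : ∃ K : ℝ, ∀ t ∈ spectrum ℝ x, |t| ≤ K :=
    ((spectrum.isCompact (𝕜 := ℝ) x).isBounded.exists_norm_le)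
  have hbound : ∀ s : ℝ, ∀ t ∈ spectrum ℝ x, ‖t / (s ^ 2 + t ^ 2)‖ ≤ K * (s ^ 2 + δ ^ 2)⁻¹ := by
    intro s t ht
    have h1 := hspec t ht
    have h2 := hK t ht
    have h3 : δ ^ 2 ≤ t ^ 2 := by rw [← sq_abs t]; gcongr
    rw [norm_div, div_eq_mul_inv, Real.norm_eq_abs, Real.norm_of_nonneg (by positivity)]
    gcongr
    exact (abs_nonneg t).trans h2
  have hcont : ContinuousOn (Function.uncurry fun s t : ℝ => t / (s ^ 2 + t ^ 2))
      (Ioi 0 ×ˢ spectrum ℝ x) := by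
    refine ContinuousOn.div (by fun_prop) (by fun_prop) fun p hp => ?_
    have : 0 < p.1 := hp.1
    positivity
  have hbint : IntegrableOn (fun s : ℝ => K * (s ^ 2 + δ ^ 2)⁻¹) (Ioi 0) := by
    refine Integrable.const_mul ?_ K
    have h1 := ((integrable_inv_one_add_sq.comp_div hδ.ne').const_mul (δ ^ 2)⁻¹).integrableOn
      (s := Ioi 0)
    refine h1.congr (.of_forall fun s => ?_)
    field_simp
    ring
  have hbae : ∀ᵐ s ∂(volume.restrict (Ioi (0 : ℝ))), ∀ t ∈ spectrum ℝ x,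
      ‖t / (s ^ 2 + t ^ 2)‖ ≤ K * (s ^ 2 + δ ^ 2)⁻¹ := .of_forall hbound
  have hcfc : cfc (fun t : ℝ => Real.pi / 2 * (1 - 2 * g t)) x =
      ∫ s in Ioi (0 : ℝ), cfc (fun t : ℝ => t / (s ^ 2 + t ^ 2)) x := by
    rw [← cfc_setIntegral measurableSet_Ioi _ _ x hcont hbae hbint.2]
    refine cfc_congr fun t ht => ?_
    rcases lt_trichotomy t 0 with h | h | h
    · have := integral_Ioi_div_sq_add_sq (neg_pos.2 h)
      simp only [neg_div, neg_sq, integral_neg] at this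
      rw [hneg t ht h]
      linarith
    · have := hspec t ht
      simp [h] at this
      linarith
    · rw [hpos t ht h.le]
      simpa using (integral_Ioi_div_sq_add_sq h).symm
  have hcint := integrableOn_cfc measurableSet_Ioi _ _ x hcont hbae hbint.2
  have e1 : (trLog φ (-Complex.I • x)).im =
      ∫ s in Ioi (0 : ℝ), (φ.tr (res 1 s - res (-Complex.I • x) s)).im :=
    (integral_im hdiff).symm
  rw [e1, setIntegral_congr_fun measurableSet_Ioi him, integral_neg]
  have e2 : ∫ s in Ioi (0 : ℝ), (φ.clm (cfc (fun t : ℝ => t / (s ^ 2 + t ^ 2)) x)).re =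
      (∫ s in Ioi (0 : ℝ), φ.clm (cfc (fun t : ℝ => t / (s ^ 2 + t ^ 2)) x)).re :=
    integral_re (φ.clm.integrable_comp hcint)
  rw [e2, φ.clm.integral_comp_comm hcint, ← hcfc]
  have e3 : cfc (fun t : ℝ => Real.pi / 2 * (1 - 2 * g t)) x =
      ((Real.pi / 2 : ℝ) : ℂ) • (1 - (2 : ℂ) • cfc g x) := by
    have e4 : ((2 : ℝ) : ℂ) • cfc g x = (2 : ℂ) • cfc g x := by norm_num
    rw [← e4, Complex.coe_smul, Complex.coe_smul, ← cfc_one ℝ x,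
      ← cfc_smul _ _ x hg.continuousOn, ← cfc_sub _ _ x, ← cfc_smul _ _ x]
    rfl
  rw [e3, map_smul, smul_eq_mul, Complex.re_ofReal_mul, map_sub, map_smul, φ.clm_apply,
    φ.clm_apply, φ.unital]
  simp

end Boundary

section AtInfinity

variable {A : Type*} [CStarAlgebra A] [PartialOrder A] (φ : TracialState A)

lemma TracialState.tr_algebraMap (r : ℝ) : φ.tr (algebraMap ℝ A r) = r := by
  rw [Algebra.algebraMap_eq_smul_one, ← Complex.coe_smul, map_smul, φ.unital, smul_eq_mul, mul_one]

lemma im_trLog_algebraMap {c : ℝ} (hc : 0 < c) : (trLog φ (algebraMap ℝ A c)).im = 0 := by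
  have h : ∀ s ∈ Ioi (0 : ℝ), φ.tr (res 1 s - res (algebraMap ℝ A c) s) =
      (((1 + s)⁻¹ - (c + s)⁻¹ : ℝ) : ℂ) := by
    intro s hs
    have hs : 0 < s := hs
    have h1 : ∀ r : ℝ, 0 < r → res (algebraMap ℝ A r) s = algebraMap ℝ A (r + s)⁻¹ := by
      intro r hr
      have h2 : r + s ≠ 0 := by positivity
      rw [res, ← map_add]
      refine Ring.inverse_unit ⟨_, algebraMap ℝ A (r + s)⁻¹, ?_, ?_⟩
      · rw [← map_mul, mul_inv_cancel₀ h2, map_one]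
      · rw [← map_mul, inv_mul_cancel₀ h2, map_one]
    rw [← map_one (algebraMap ℝ A), h1 1 one_pos, h1 c hc, ← map_sub, φ.tr_algebraMap]
  rw [trLog, setIntegral_congr_fun measurableSet_Ioi h, integral_complex_ofReal, Complex.ofReal_im]

variable [StarOrderedRing A] {φ} {b : A} {S : A →L[ℂ] A} {w : ℝ → A} {L : ℝ}

lemma IsFlow.exists_abs_im_freeEnergy_le (h : IsFlow b S w L)
    (hw : ∀ η, 0 < η → ‖w η‖ ≤ 2 * η⁻¹) :
    ∃ K : ℝ, ∀ H, 1 ≤ H → |(freeEnergy φ b S (w H) H).im| ≤ K * H⁻¹ := by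
  set B : ℝ := ‖b‖ + ‖S‖ * 2
  set M : ℝ := ‖(1 : A)‖ + B + 1
  refine ⟨‖φ.clm‖ * M ^ 2 * (2 * B) + ‖φ.clm‖ * (2 * B) + ‖φ.clm‖ * (2 * B)
    + ‖φ.clm‖ * (2 * B), fun H hH => ?_⟩
  have hH0 : 0 < H := by linarith
  have hHi : H⁻¹ ≤ 1 := inv_le_one_of_one_le₀ hH
  have hw2 : ‖w H‖ ≤ 2 * H⁻¹ := hw H hH0
  have hSw : ‖S (w H)‖ ≤ ‖S‖ * 2 :=
    (S.le_opNorm _).trans (by gcongr; linarith)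
  have hu : ‖b + S (w H)‖ ≤ B := (norm_add_le _ _).trans (by simp only [B]; gcongr)
  have hB : 0 ≤ B := (norm_nonneg _).trans hu
  have halg : ∀ r : ℝ, 0 ≤ r → ‖algebraMap ℝ A r‖ = r * ‖(1 : A)‖ := fun r hr => by
    rw [norm_algebraMap, Real.norm_of_nonneg hr]
  have r0 : ResBound (1 : A) H⁻¹ M := by
    refine ResBound.of_accretive (v := 1) (mul_one 1) (mul_one 1)
      (by rw [star_one]; exact add_nonneg zero_le_one zero_le_one) (inv_pos.2 hH0) ?_
    simp only [M]
    nlinarith [norm_nonneg (1 : A)]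
  have r1 : ResBound (algebraMap ℝ A H⁻¹) H⁻¹ M := by
    refine ResBound.of_accretive (v := algebraMap ℝ A H) ?_ ?_ ?_ (inv_pos.2 hH0) ?_
    · rw [← map_mul, inv_mul_cancel₀ hH0.ne', map_one]
    · rw [← map_mul, mul_inv_cancel₀ hH0.ne', map_one]
    · rw [(IsSelfAdjoint.algebraMap A (.all H⁻¹)).star_eq]
      exact add_nonneg (algebraMap_nonneg A (by positivity)) (algebraMap_nonneg A (by positivity))
    · rw [halg H hH0.le, ← mul_assoc, inv_mul_cancel₀ hH0.ne']
      simp only [M]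
      linarith
  have r2 : ResBound (w H) H⁻¹ M := by
    refine ResBound.of_accretive (h.mul_eq_one H hH0.le) (h.eq_mul_one H hH0.le)
      (h.accretive H hH0.le) (inv_pos.2 hH0) ?_
    have h1 : ‖algebraMap ℝ A H + b + S (w H)‖ ≤ H * ‖(1 : A)‖ + B := by
      rw [add_assoc, ← halg H hH0.le]
      exact (norm_add_le _ _).trans (by gcongr)
    calc _ ≤ H⁻¹ * (H * ‖(1 : A)‖ + B) + 1 := by gcongr
      _ = ‖(1 : A)‖ + H⁻¹ * B + 1 := by field_simp
      _ ≤ _ := by simp only [M]; nlinarith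
  have hHw : algebraMap ℝ A H * w H = 1 - (b + S (w H)) * w H := by
    rw [← h.eq_mul_one H hH0.le]
    noncomm_ring
  have hdiff : ‖w H - algebraMap ℝ A H⁻¹‖ ≤ H⁻¹ * (B * (2 * H⁻¹)) := by
    have e : w H - algebraMap ℝ A H⁻¹ = algebraMap ℝ A H⁻¹ * (-((b + S (w H)) * w H)) := by
      have : w H = algebraMap ℝ A H⁻¹ * (algebraMap ℝ A H * w H) := by
        rw [← mul_assoc, ← map_mul, inv_mul_cancel₀ hH0.ne', map_one, one_mul]
      conv_lhs => rw [this, hHw]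
      noncomm_ring
    rw [e, Algebra.algebraMap_eq_smul_one, smul_mul_assoc, one_mul, norm_smul, norm_neg,
      Real.norm_of_nonneg (by positivity)]
    gcongr
    exact (norm_mul_le _ _).trans (by gcongr)
  have h1 : |(trLog φ (w H)).im| ≤ ‖φ.clm‖ * M ^ 2 * (2 * B) * H⁻¹ := by
    have := norm_trLog_sub_trLog_le φ (inv_pos.2 hH0) r0 r1 r2
    have h2 := (Complex.abs_im_le_norm _).trans this
    rw [Complex.sub_im, im_trLog_algebraMap φ (inv_pos.2 hH0), sub_zero] at h2
    calc _ ≤ _ := h2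
      _ ≤ ‖φ.clm‖ * M ^ 2 * (H⁻¹ * (B * (2 * H⁻¹))) * H⁻¹⁻¹ := by gcongr
      _ = _ := by field_simp
  have hmul : ∀ u : A, ‖u‖ ≤ B → ‖φ.tr (u * w H)‖ ≤ ‖φ.clm‖ * (2 * B) * H⁻¹ := by
    intro u hu
    calc _ ≤ ‖φ.clm‖ * (‖u‖ * ‖w H‖) := (φ.norm_tr_le _).trans (by gcongr; exact norm_mul_le _ _)
      _ ≤ ‖φ.clm‖ * (B * (2 * H⁻¹)) := by gcongr
      _ = _ := by ring
  have h2 : |((H : ℂ) * φ.tr (w H)).im| ≤ ‖φ.clm‖ * (2 * B) * H⁻¹ := by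
    have e : (H : ℂ) * φ.tr (w H) = 1 - φ.tr ((b + S (w H)) * w H) := by
      rw [← φ.unital, ← map_sub, ← hHw, Algebra.algebraMap_eq_smul_one, smul_mul_assoc, one_mul,
        ← Complex.coe_smul, map_smul, smul_eq_mul]
    rw [e, Complex.sub_im, Complex.one_im, zero_sub, abs_neg]
    exact (Complex.abs_im_le_norm _).trans (hmul _ hu)
  have h3 : |(φ.tr (b * w H)).im| ≤ ‖φ.clm‖ * (2 * B) * H⁻¹ :=
    (Complex.abs_im_le_norm _).trans (hmul _ (by simp only [B]; linarith [norm_nonneg S]))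
  have h4 : |((1 / 2 : ℂ) * φ.tr (w H * S (w H))).im| ≤ ‖φ.clm‖ * (2 * B) * H⁻¹ := by
    refine (Complex.abs_im_le_norm _).trans ?_
    rw [norm_mul, φ.tracial]
    have h5 : ‖(1 / 2 : ℂ)‖ ≤ 1 := by norm_num
    have h6 := hmul (S (w H)) (by simp only [B]; linarith [norm_nonneg b])
    nlinarith [norm_nonneg (φ.tr (S (w H) * w H))]
  rw [freeEnergy]
  simp only [Complex.sub_im, Complex.add_im]
  rw [abs_le] at *
  constructor <;> linarith

end AtInfinity

section Arctan

variable {μ : Measure ℝ} [IsProbabilityMeasure μ] {τ ε : ℝ}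

lemma hasDerivAt_integral_arctan (hε : 0 < ε) (hgap : ∀ᵐ t ∂μ, ε ≤ |t - τ|) (η : ℝ) :
    HasDerivAt (fun η => ∫ t, Real.arctan (η / (t - τ)) ∂μ)
      (∫ t, (t - τ) / ((t - τ) ^ 2 + η ^ 2) ∂μ) η := by
  have hmeas : ∀ η : ℝ, AEStronglyMeasurable (fun t => Real.arctan (η / (t - τ))) μ := fun η =>
    (Real.measurable_arctan.comp (by fun_prop)).aestronglyMeasurable
  refine (hasDerivAt_integral_of_dominated_loc_of_deriv_le (bound := fun _ => ε⁻¹)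
    (F := fun η t => Real.arctan (η / (t - τ)))
    (F' := fun η t => (t - τ) / ((t - τ) ^ 2 + η ^ 2)) (s := univ) univ_mem
    (.of_forall hmeas) ?_ ?_ ?_ (integrable_const _) ?_).2
  · refine Integrable.of_bound (C := Real.pi / 2) (hmeas η) (.of_forall fun t => ?_)
    rw [Real.norm_eq_abs, abs_le]
    exact ⟨(Real.neg_pi_div_two_lt_arctan _).le, (Real.arctan_lt_pi_div_two _).le⟩
  · have : Measurable fun t : ℝ => (t - τ) / ((t - τ) ^ 2 + η ^ 2) := by fun_prop
    exact this.aestronglyMeasurable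
  · filter_upwards [hgap] with t ht x _
    have h1 : 0 < |t - τ| := hε.trans_le ht
    rw [norm_div, Real.norm_eq_abs, Real.norm_of_nonneg (by positivity), ← sq_abs (t - τ),
      div_le_iff₀ (by positivity), ← div_eq_inv_mul, le_div_iff₀ hε]
    nlinarith [sq_nonneg x]
  · filter_upwards [hgap] with t ht x _
    have h1 : t - τ ≠ 0 := abs_pos.1 (hε.trans_le ht)
    have h := (Real.hasDerivAt_arctan (x / (t - τ))).comp x ((hasDerivAt_id x).div_const (t - τ))
    refine h.congr_deriv ?_
    have h2 : (t - τ) ^ 2 + x ^ 2 ≠ 0 := by positivity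
    have h3 : 1 + (x / (t - τ)) ^ 2 ≠ 0 := by positivity
    field_simp

lemma tendsto_integral_arctan (hε : 0 < ε) (hgap : ∀ᵐ t ∂μ, ε ≤ |t - τ|) :
    Tendsto (fun η => ∫ t, Real.arctan (η / (t - τ)) ∂μ) atTop
      (𝓝 (Real.pi / 2 * (μ.real (Ioi τ) - μ.real (Iio τ)))) := by
  have hlim : ∫ t, ((Ioi τ).indicator (fun _ => Real.pi / 2) t
      - (Iio τ).indicator (fun _ => Real.pi / 2) t) ∂μ =
      Real.pi / 2 * (μ.real (Ioi τ) - μ.real (Iio τ)) := by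
    rw [integral_sub ((integrable_const _).indicator measurableSet_Ioi)
      ((integrable_const _).indicator measurableSet_Iio),
      integral_indicator_const _ measurableSet_Ioi, integral_indicator_const _ measurableSet_Iio]
    simp only [smul_eq_mul]
    ring
  rw [← hlim]
  refine tendsto_integral_filter_of_dominated_convergence (fun _ => Real.pi / 2)
    (.of_forall fun η => (Real.measurable_arctan.comp (by fun_prop)).aestronglyMeasurable)
    (.of_forall fun η => .of_forall fun t => ?_) (integrable_const _) ?_
  · rw [Real.norm_eq_abs, abs_le]
    exact ⟨(Real.neg_pi_div_two_lt_arctan _).le, (Real.arctan_lt_pi_div_two _).le⟩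
  · filter_upwards [hgap] with t ht
    have h1 : t - τ ≠ 0 := abs_pos.1 (hε.trans_le ht)
    rcases lt_or_gt_of_ne h1 with h | h
    · have h2 : t < τ := by linarith
      rw [indicator_of_notMem (by simpa using h2.le), indicator_of_mem (by simpa using h2),
        zero_sub]
      exact (tendsto_nhds_of_tendsto_nhdsWithin Real.tendsto_arctan_atBot).comp
        (tendsto_id.atTop_div_const_of_neg h)
    · have h2 : τ < t := by linarith
      rw [indicator_of_mem (by simpa using h2), indicator_of_notMem (by simpa using h2.le),
        sub_zero]
      exact (tendsto_nhds_of_tendsto_nhdsWithin Real.tendsto_arctan_atTop).comp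
        (tendsto_id.atTop_div_const h)

end Arctan

section Boundary

variable {A : Type*} [CStarAlgebra A] [PartialOrder A] [StarOrderedRing A]

lemma PosPreserving.isSelfAdjoint {S : A →L[ℂ] A} (hS : PosPreserving S) {x : A}
    (hx : IsSelfAdjoint x) : IsSelfAdjoint (S x) := by
  rw [← CFC.posPart_sub_negPart x hx, map_sub]
  exact (IsSelfAdjoint.of_nonneg (hS _ (CFC.posPart_nonneg x))).sub
    (.of_nonneg (hS _ (CFC.negPart_nonneg x)))

lemma PosPreserving.map_star {S : A →L[ℂ] A} (hS : PosPreserving S) (x : A) :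
    S (star x) = star (S x) := by
  have h1 := (hS.isSelfAdjoint (realPart x).2).star_eq
  have h2 := (hS.isSelfAdjoint (imaginaryPart x).2).star_eq
  conv_lhs => rw [← realPart_add_I_smul_imaginaryPart x]
  conv_rhs => rw [← realPart_add_I_smul_imaginaryPart x]
  rw [star_add, star_smul, (realPart x).2.star_eq, (imaginaryPart x).2.star_eq, map_add, map_smul,
    map_add, map_smul, star_add, star_smul, h1, h2]

lemma tr_map_mul {φ : TracialState A} {S : A →L[ℂ] A} (hS : PosPreserving S)
    (hSsym : SymmOp φ S) (x y : A) : φ.tr (S x * y) = φ.tr (x * S y) := by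
  have := hSsym (star x) y
  rwa [hS.map_star, star_star, star_star] at this

lemma TracialState.im_tr_mul (φ : TracialState A) {x y : A} (hx : IsSelfAdjoint x)
    (hy : IsSelfAdjoint y) : (φ.tr (x * y)).im = 0 := by
  have h := φ.tr_star (x * y)
  rw [star_mul, hx.star_eq, hy.star_eq, φ.tracial] at h
  exact Complex.conj_eq_iff_im.1 h.symm

lemma im_freeEnergy_zero (φ : TracialState A) {S : A →L[ℂ] A} (hS : PosPreserving S) {h x : A}
    (hh : IsSelfAdjoint h) (hx : IsSelfAdjoint x) :
    (freeEnergy φ (Complex.I • h) S (-Complex.I • x) 0).im = (trLog φ (-Complex.I • x)).im := by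
  have e1 : (Complex.I • h) * (-Complex.I • x) = h * x := by
    simp [smul_smul]
  have e2 : (-Complex.I • x) * S (-Complex.I • x) = -(x * S x) := by
    rw [map_smul, smul_mul_smul_comm]
    simp
  rw [freeEnergy, e1, e2, map_neg]
  simp [φ.im_tr_mul hh hx, φ.im_tr_mul hx (hS.isSelfAdjoint hx)]

/-- Along the vertical line above a point outside the support the solution is a flow up to the
boundary. -/
lemma isFlow_of_isDysonSolution {a : A} {S : A →L[ℂ] A} {m : ℂ → A} (hm : IsDysonSolution a S m)
    {τ L : ℝ} {N : ℝ → A} (hN : ∀ η : ℝ, 0 < η → N η = m ((τ : ℂ) + (η : ℂ) * Complex.I))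
    (hL : ∀ η₁ η₂ : ℝ, 0 ≤ η₁ → 0 ≤ η₂ → ‖N η₁ - N η₂‖ ≤ L * |η₁ - η₂|) :
    IsFlow (Complex.I • (a - algebraMap ℝ A τ)) S (fun η => -Complex.I • N η) L := by
  have hcont : Tendsto N (𝓝[>] 0) (𝓝 (N 0)) := by
    rw [tendsto_iff_norm_sub_tendsto_zero]
    have h0 : Tendsto (fun η : ℝ => L * |η - 0|) (𝓝[>] 0) (𝓝 0) := by
      have : Continuous fun η : ℝ => L * |η - 0| := by fun_prop
      simpa using (this.tendsto 0).mono_left nhdsWithin_le_nhds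
    refine squeeze_zero' (.of_forall fun _ => norm_nonneg _) ?_ h0
    filter_upwards [self_mem_nhdsWithin] with η hη
    exact hL η 0 (le_of_lt hη) le_rfl
  have hw : Tendsto (fun η => -Complex.I • N η) (𝓝[>] 0) (𝓝 (-Complex.I • N 0)) :=
    hcont.const_smul _
  have hv : Tendsto (fun η => algebraMap ℝ A η + Complex.I • (a - algebraMap ℝ A τ)
      + S (-Complex.I • N η)) (𝓝[>] 0) (𝓝 (algebraMap ℝ A 0 + Complex.I • (a - algebraMap ℝ A τ)
      + S (-Complex.I • N 0))) := by
    have h1 : Tendsto (fun η : ℝ => algebraMap ℝ A η) (𝓝[>] 0) (𝓝 (algebraMap ℝ A 0)) :=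
      ((continuous_algebraMap ℝ A).tendsto 0).mono_left nhdsWithin_le_nhds
    exact (h1.add_const _).add ((S.continuous.tendsto _).comp hw)
  have hvz : ∀ η : ℝ, 0 < η → algebraMap ℝ A η + Complex.I • (a - algebraMap ℝ A τ)
      + S (-Complex.I • N η) = -Complex.I • (((τ : ℂ) + (η : ℂ) * Complex.I) • (1 : A) - a
        + S (N η)) := by
    intro η _
    rw [Algebra.algebraMap_eq_smul_one, Algebra.algebraMap_eq_smul_one, map_smul,
      ← Complex.coe_smul, ← Complex.coe_smul]
    match_scalars
    · linear_combination (η : ℂ) * Complex.I_mul_I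
    · ring
    · ring
  have e : ∀ x y : A, x * y = -1 → (-Complex.I • x) * (-Complex.I • y) = 1 := by
    intro x y h
    rw [smul_mul_smul_comm, h]
    simp
  have hz : ∀ η : ℝ, 0 < η → 0 < ((τ : ℂ) + (η : ℂ) * Complex.I).im := fun η h => by simpa
  have h1 : ∀ η, 0 < η → (-Complex.I • N η) * (algebraMap ℝ A η
      + Complex.I • (a - algebraMap ℝ A τ) + S (-Complex.I • N η)) = 1 := fun η hη => by
    rw [hvz η hη]
    refine e _ _ ?_
    rw [hN η hη]
    exact (hm _ (hz η hη)).2.1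
  have h2 : ∀ η, 0 < η → (algebraMap ℝ A η + Complex.I • (a - algebraMap ℝ A τ)
      + S (-Complex.I • N η)) * (-Complex.I • N η) = 1 := fun η hη => by
    rw [hvz η hη]
    refine e _ _ ?_
    rw [hN η hη]
    exact (hm _ (hz η hη)).2.2
  have h3 : ∀ η, 0 < η → 0 ≤ (-Complex.I • N η) + star (-Complex.I • N η) := fun η hη => by
    obtain ⟨c, hc, hle⟩ := (hm _ (hz η hη)).1
    rw [← hN η hη] at hle
    have h4 : 0 ≤ imA (N η) := by
      refine le_trans ?_ hle
      rw [Complex.coe_smul, ← Algebra.algebraMap_eq_smul_one]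
      exact algebraMap_nonneg A hc.le
    have h5 : (-Complex.I • N η) + star (-Complex.I • N η) = imA (N η) + imA (N η) := by
      rw [imA, star_smul]
      simp only [mul_inv, Complex.inv_I, star_neg, Complex.star_def, Complex.conj_I]
      match_scalars <;> ring
    rw [h5]
    exact add_nonneg h4 h4
  refine ⟨fun η hη => ?_, fun η hη => ?_, fun η hη => ?_, fun η₁ η₂ hη₁ hη₂ => ?_⟩
  · rcases hη.eq_or_lt with rfl | hη
    · refine tendsto_nhds_unique (hw.mul hv) (tendsto_const_nhds.congr' ?_)
      filter_upwards [self_mem_nhdsWithin] with η hη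
      exact (h1 η hη).symm
    · exact h1 η hη
  · rcases hη.eq_or_lt with rfl | hη
    · refine tendsto_nhds_unique (hv.mul hw) (tendsto_const_nhds.congr' ?_)
      filter_upwards [self_mem_nhdsWithin] with η hη
      exact (h2 η hη).symm
    · exact h2 η hη
  · rcases hη.eq_or_lt with rfl | hη
    · refine CStarAlgebra.isClosed_nonneg.mem_of_tendsto (hw.add hw.star) ?_
      filter_upwards [self_mem_nhdsWithin] with η hη
      exact h3 η hη
    · exact h3 η hη
  · rw [← smul_sub, norm_smul]
    simpa using hL η₁ η₂ hη₁ hη₂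

end Boundary

section BandMass

variable {A : Type*} [CStarAlgebra A] [PartialOrder A]
  {φ : TracialState A} {v : OpMeasure A φ} {a : A} {S : A →L[ℂ] A} {m : ℂ → A}

lemma re_tr_stieltjes (hrep : StieltjesRep φ v m) (τ : ℝ) {η : ℝ} (hη : 0 < η) :
    (φ.tr (m ((τ : ℂ) + (η : ℂ) * Complex.I))).re =
      ∫ t, (t - τ) / ((t - τ) ^ 2 + η ^ 2) ∂v.dos := by
  have : IsFiniteMeasure v.dos := v.scalarFin 1
  have hz : 0 < ((τ : ℂ) + (η : ℂ) * Complex.I).im := by simpa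
  have h := hrep _ hz 1
  rw [star_one, one_mul, mul_one] at h
  have h2 : ∫ t, (((t : ℂ) - ((τ : ℂ) + (η : ℂ) * Complex.I))⁻¹).re ∂v.dos =
      (∫ t, ((t : ℂ) - ((τ : ℂ) + (η : ℂ) * Complex.I))⁻¹ ∂v.dos).re :=
    integral_re (integrable_stieltjes hz)
  rw [h]
  refine h2.symm.trans (integral_congr_ae (.of_forall fun t => ?_))
  simp only [Complex.inv_re, Complex.normSq_apply]
  simp [pow_two]

variable [StarOrderedRing A]

/-- The band mass formula, for the boundary value of the Stieltjes transform in a spectral gap. -/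
theorem exists_boundary_value (ha : IsSelfAdjoint a) (hS : PosPreserving S) (hSsym : SymmOp φ S)
    (hm : IsDysonSolution a S m) (hv : v.val univ = 1) (hrep : StieltjesRep φ v m) {τ : ℝ}
    (hτ : τ ∉ measSupp v.dos) :
    ∃ x y : A, IsSelfAdjoint x ∧ x * y = 1 ∧ y * x = 1 ∧
      Tendsto (fun η : ℝ => m ((τ : ℂ) + (η : ℂ) * Complex.I)) (𝓝[>] 0) (𝓝 x) ∧
      ∀ g : ℝ → ℝ, Continuous g → (∀ t ∈ spectrum ℝ x, t < 0 → g t = 1) →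
        (∀ t ∈ spectrum ℝ x, 0 ≤ t → g t = 0) →
        (v.dos (Iio τ)).toReal = (φ.tr (cfc g x)).re := by
  have := isProbabilityMeasure_dos hv
  obtain ⟨ε, hε, hgap⟩ := exists_gap_of_notMem_measSupp hτ
  obtain ⟨N, hN, hN0, hL⟩ := exists_lipschitz_extension hv hrep hε hgap
  set b : A := Complex.I • (a - algebraMap ℝ A τ)
  have hf : IsFlow b S (fun η => -Complex.I • N η) (2 * ε⁻¹ ^ 2) := isFlow_of_isDysonSolution hm hN hL
  have hae : ∀ᵐ t ∂v.dos, ε ≤ |t - τ| := ae_gap hgap 1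
  obtain ⟨u, hu⟩ : ∃ u : A, u = algebraMap ℝ A 0 + b + S (-Complex.I • N 0) := ⟨_, rfl⟩
  have e1 : (-Complex.I • N 0) * u = 1 := hu ▸ hf.mul_eq_one 0 le_rfl
  have e2 : u * (-Complex.I • N 0) = 1 := hu ▸ hf.eq_mul_one 0 le_rfl
  have hxy : N 0 * (-Complex.I • u) = 1 := by rw [← e1, mul_smul_comm, smul_mul_assoc]
  have hyx : (-Complex.I • u) * N 0 = 1 := by rw [← e2, mul_smul_comm, smul_mul_assoc]
  refine ⟨N 0, -Complex.I • u, hN0, hxy, hyx, ?_, fun g hg hneg hpos => ?_⟩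
  · have h1 : Tendsto N (𝓝[>] 0) (𝓝 (N 0)) := by
      rw [tendsto_iff_norm_sub_tendsto_zero]
      have h0 : Tendsto (fun η : ℝ => 2 * ε⁻¹ ^ 2 * |η - 0|) (𝓝[>] 0) (𝓝 0) := by
        have : Continuous fun η : ℝ => 2 * ε⁻¹ ^ 2 * |η - 0| := by fun_prop
        simpa using (this.tendsto 0).mono_left nhdsWithin_le_nhds
      refine squeeze_zero' (.of_forall fun _ => norm_nonneg _) ?_ h0
      filter_upwards [self_mem_nhdsWithin] with η hη
      exact hL η 0 (le_of_lt hη) le_rfl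
    refine h1.congr' ?_
    filter_upwards [self_mem_nhdsWithin] with η hη
    exact hN η hη
  · set F : ℝ → ℝ := fun η => (freeEnergy φ b S (-Complex.I • N η) η).im
    set G : ℝ → ℝ := fun η => ∫ t, Real.arctan (η / (t - τ)) ∂v.dos
    have hF : ∀ η, 0 ≤ η → HasDerivWithinAt F (φ.tr (N η)).re (Ici 0) η := by
      intro η hη
      have h1 := hf.hasDerivWithinAt φ (tr_map_mul hS hSsym) hη
      have h2 := Complex.imCLM.hasFDerivAt.comp_hasDerivWithinAt η h1
      refine h2.congr_deriv ?_
      simp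
    have hG := hasDerivAt_integral_arctan hε hae
    have hderiv : ∀ η, 0 < η → HasDerivAt (fun η => F η - G η) 0 η := by
      intro η hη
      have h1 := ((hF η hη.le).hasDerivAt (Ici_mem_nhds hη)).sub (hG η)
      refine h1.congr_deriv ?_
      rw [hN η hη, re_tr_stieltjes hrep τ hη, sub_self]
    have hcont : ContinuousOn (fun η => F η - G η) (Ici 0) := fun η hη =>
      ((hF η hη).continuousWithinAt).sub (hG η).continuousAt.continuousWithinAt
    have hconst : ∀ H, 0 < H → F H - G H = F 0 - G 0 := by
      intro H hH
      obtain ⟨c, hc, h⟩ := exists_hasDerivAt_eq_slope (fun η => F η - G η) (fun _ => 0) hH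
        (hcont.mono Icc_subset_Ici_self) fun x hx => hderiv x hx.1
      rw [eq_comm, div_eq_zero_iff] at h
      rcases h with h | h <;> linarith
    have hF0 : F 0 = -(Real.pi / 2 * (1 - 2 * (φ.tr (cfc g (N 0))).re)) := by
      have hh : IsSelfAdjoint (a - algebraMap ℝ A τ) := ha.sub (.algebraMap A (.all τ))
      exact (im_freeEnergy_zero φ hS hh hN0).trans (im_trLog_neg_I_smul φ hN0 hxy hyx hg hneg hpos)
    have hG0 : G 0 = 0 := by simp [G]
    obtain ⟨K, hK⟩ := hf.exists_abs_im_freeEnergy_le (φ := φ) fun η hη => by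
      rw [norm_smul, hN η hη]
      simpa using norm_stieltjes_le hv hrep (z := (τ : ℂ) + (η : ℂ) * Complex.I) (by simpa)
    have hFlim : Tendsto F atTop (𝓝 0) := by
      have h1 : Tendsto (fun H : ℝ => K * H⁻¹) atTop (𝓝 0) := by
        simpa using tendsto_inv_atTop_zero.const_mul K
      refine squeeze_zero_norm' ?_ h1
      filter_upwards [eventually_ge_atTop 1] with H hH
      exact hK H hH
    have hlim := hFlim.sub (tendsto_integral_arctan hε hae)
    have heq := tendsto_nhds_unique hlim
      (tendsto_const_nhds.congr' ((eventually_gt_atTop 0).mono fun H hH => (hconst H hH).symm))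
    rw [hF0, hG0] at heq
    have hsum : v.dos.real (Iio τ) + v.dos.real (Ioi τ) = 1 := by
      have h1 : v.dos.real (Ici τ) = v.dos.real (Ioi τ) := by
        have h2 : v.dos {τ} = 0 :=
          measure_mono_null (singleton_subset_iff.2 (mem_Ioo.2 ⟨by linarith, by linarith⟩)) hgap
        refine measureReal_congr (Ioi_ae_eq_Ici' h2).symm
      rw [← h1, ← probReal_univ (μ := v.dos), ← compl_Iio]
      exact measureReal_add_measureReal_compl measurableSet_Iio
    have hpi := Real.pi_pos
    have h3 : Real.pi / 2 * (v.dos.real (Ioi τ) - v.dos.real (Iio τ)) =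
        Real.pi / 2 * (1 - 2 * (φ.tr (cfc g (N 0))).re) := by linarith
    have h4 := mul_left_cancel₀ (by positivity) h3
    change v.dos.real (Iio τ) = _
    linarith

end BandMass

section Components

lemma exists_forall_le_of_mul_eq_natCast {B : Set ℝ} (hB : B.Nonempty) {f : ℝ → ℝ} {n : ℕ}
    (hn : 0 < n) (h : ∀ y ∈ B, ∃ k : ℕ, n * f y = k) : ∃ y₀ ∈ B, ∀ y ∈ B, f y₀ ≤ f y := by
  choose! k hk using h
  obtain ⟨j, ⟨y₀, hy₀, rfl⟩, hmin⟩ := wellFounded_lt.has_min (k '' B) (hB.image k)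
  refine ⟨y₀, hy₀, fun y hy => ?_⟩
  have h1 : k y₀ ≤ k y := not_lt.1 (hmin _ (mem_image_of_mem k hy))
  have h2 : (n : ℝ) * f y₀ ≤ n * f y := by
    rw [hk y₀ hy₀, hk y hy]
    exact_mod_cast h1
  exact le_of_mul_le_mul_left h2 (by exact_mod_cast hn)

lemma isClosed_measSupp (μ : Measure ℝ) : IsClosed (measSupp μ) := by
  rw [← isOpen_compl_iff, Metric.isOpen_iff]
  intro y hy
  obtain ⟨ε, hε, h⟩ := exists_gap_of_notMem_measSupp hy
  refine ⟨ε / 2, by positivity, fun x hx hmem => hmem (ε / 2) (by positivity) ?_⟩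
  rw [Metric.mem_ball, Real.dist_eq, abs_lt] at hx
  exact measure_mono_null (Ioo_subset_Ioo (by linarith) (by linarith)) h

lemma measure_ne_zero_of_mem_measSupp {μ : Measure ℝ} {τ : ℝ} (hτ : τ ∈ measSupp μ) {U : Set ℝ}
    (hU : U ∈ 𝓝 τ) : μ U ≠ 0 := by
  obtain ⟨ε, hε, h⟩ := Metric.mem_nhds_iff.1 hU
  rw [Real.ball_eq_Ioo] at h
  exact fun h0 => hτ ε hε (measure_mono_null h h0)

variable {μ : Measure ℝ} [IsProbabilityMeasure μ] {n : ℕ}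

lemma measure_inter_compl_eq_zero {U V : Set ℝ} (hV : MeasurableSet V) (hUV : V ⊆ U ∨ U ⊆ V)
    (h : μ.real U ≤ μ.real V) : μ (U ∩ Vᶜ) = 0 := by
  rcases hUV with hVU | hUV
  · have h1 := measureReal_inter_add_sdiff (μ := μ) (s := U) hV
    rw [inter_eq_self_of_subset_right hVU, Set.sdiff_eq] at h1
    exact (measureReal_eq_zero_iff).1 (le_antisymm (by linarith) measureReal_nonneg)
  · rw [← Set.sdiff_eq, sdiff_eq_empty.2 hUV, measure_empty]

/-- To the right of a point of the support, the mass can be cut off at the end of the connected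
component. -/
lemma exists_right_cut (hn : 0 < n)
    (h : ∀ y ∉ measSupp μ, ∃ k : ℕ, n * μ.real (Iio y) = k) {τ : ℝ} (hτ : τ ∈ measSupp μ) :
    ∃ U : Set ℝ, IsOpen U ∧ Iic τ ⊆ U ∧ (∃ k : ℕ, n * μ.real U = k) ∧
      connectedComponentIn (measSupp μ) τ ⊆ U ∧
      μ {x ∈ U | τ < x ∧ x ∉ connectedComponentIn (measSupp μ) τ} = 0 := by
  have hloc : ∀ U : Set ℝ, IsOpen U → (∀ y ∉ measSupp μ, τ < y → μ (U ∩ Ici y) = 0) →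
      μ {x ∈ U | τ < x ∧ x ∉ connectedComponentIn (measSupp μ) τ} = 0 := by
    intro U hU hnull
    refine measure_null_of_locally_null _ fun x hx => ?_
    obtain ⟨y, hy, hyF⟩ : ∃ y ∈ Icc τ x, y ∉ measSupp μ := by
      by_contra! hcon
      exact hx.2.2 (isPreconnected_Icc.subset_connectedComponentIn
        (left_mem_Icc.2 hx.2.1.le) hcon (right_mem_Icc.2 hx.2.1.le))
    have hτy : τ < y := lt_of_le_of_ne hy.1 fun e => hyF (e ▸ hτ)
    have hev : ∀ᶠ z in 𝓝[<] y, z ∉ measSupp μ ∧ τ < z ∧ z < y := by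
      filter_upwards [nhdsWithin_le_nhds ((isClosed_measSupp μ).isOpen_compl.mem_nhds hyF),
        nhdsWithin_le_nhds (Ioi_mem_nhds hτy), self_mem_nhdsWithin] with z h1 h2 h3
      exact ⟨h1, h2, h3⟩
    obtain ⟨z, hz1, hz2, hz3⟩ := hev.exists
    exact ⟨U ∩ Ici z, nhdsWithin_le_nhds (inter_mem (hU.mem_nhds hx.1)
      (Ici_mem_nhds (hz3.trans_le hy.2))), hnull z hz1 hz2⟩
  by_cases hB : {y | y ∉ measSupp μ ∧ τ < y}.Nonempty
  · obtain ⟨y₀, ⟨hy₀, hτy₀⟩, hmin⟩ := exists_forall_le_of_mul_eq_natCast hB hn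
      fun y hy => h y hy.1
    refine ⟨Iio y₀, isOpen_Iio, Iic_subset_Iio.2 hτy₀, h y₀ hy₀, fun x hx => ?_,
      hloc _ isOpen_Iio fun y hy hτy => ?_⟩
    · by_contra hxy
      have := (isPreconnected_connectedComponentIn (F := measSupp μ) (x := τ)).ordConnected.out
        (mem_connectedComponentIn hτ) hx ⟨hτy₀.le, not_lt.1 hxy⟩
      exact hy₀ (connectedComponentIn_subset _ _ this)
    · rw [← compl_Iio]
      refine measure_inter_compl_eq_zero measurableSet_Iio ?_ (hmin y ⟨hy, hτy⟩)
      exact (le_total y y₀).imp Iio_subset_Iio Iio_subset_Iio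
  · refine ⟨univ, isOpen_univ, subset_univ _, ⟨n, by simp⟩, subset_univ _,
      hloc _ isOpen_univ fun y hy hτy => (hB ⟨y, hy, hτy⟩).elim⟩

/-- To the left of a point of the support, the mass can be cut off at the end of the connected
component. -/
lemma exists_left_cut (hn : 0 < n)
    (h : ∀ y ∉ measSupp μ, ∃ k : ℕ, n * μ.real (Ioi y) = k) {τ : ℝ} (hτ : τ ∈ measSupp μ) :
    ∃ U : Set ℝ, IsOpen U ∧ Ici τ ⊆ U ∧ (∃ k : ℕ, n * μ.real U = k) ∧
      connectedComponentIn (measSupp μ) τ ⊆ U ∧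
      μ {x ∈ U | x < τ ∧ x ∉ connectedComponentIn (measSupp μ) τ} = 0 := by
  have hloc : ∀ U : Set ℝ, IsOpen U → (∀ y ∉ measSupp μ, y < τ → μ (U ∩ Iic y) = 0) →
      μ {x ∈ U | x < τ ∧ x ∉ connectedComponentIn (measSupp μ) τ} = 0 := by
    intro U hU hnull
    refine measure_null_of_locally_null _ fun x hx => ?_
    obtain ⟨y, hy, hyF⟩ : ∃ y ∈ Icc x τ, y ∉ measSupp μ := by
      by_contra! hcon
      exact hx.2.2 (isPreconnected_Icc.subset_connectedComponentIn
        (right_mem_Icc.2 hx.2.1.le) hcon (left_mem_Icc.2 hx.2.1.le))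
    have hτy : y < τ := lt_of_le_of_ne hy.2 fun e => hyF (e.symm ▸ hτ)
    have hev : ∀ᶠ z in 𝓝[>] y, z ∉ measSupp μ ∧ z < τ ∧ y < z := by
      filter_upwards [nhdsWithin_le_nhds ((isClosed_measSupp μ).isOpen_compl.mem_nhds hyF),
        nhdsWithin_le_nhds (Iio_mem_nhds hτy), self_mem_nhdsWithin] with z h1 h2 h3
      exact ⟨h1, h2, h3⟩
    obtain ⟨z, hz1, hz2, hz3⟩ := hev.exists
    exact ⟨U ∩ Iic z, nhdsWithin_le_nhds (inter_mem (hU.mem_nhds hx.1)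
      (Iic_mem_nhds (hy.1.trans_lt hz3))), hnull z hz1 hz2⟩
  by_cases hB : {y | y ∉ measSupp μ ∧ y < τ}.Nonempty
  · obtain ⟨y₀, ⟨hy₀, hτy₀⟩, hmin⟩ := exists_forall_le_of_mul_eq_natCast hB hn
      fun y hy => h y hy.1
    refine ⟨Ioi y₀, isOpen_Ioi, Ici_subset_Ioi.2 hτy₀, h y₀ hy₀, fun x hx => ?_,
      hloc _ isOpen_Ioi fun y hy hτy => ?_⟩
    · by_contra hxy
      have := (isPreconnected_connectedComponentIn (F := measSupp μ) (x := τ)).ordConnected.out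
        hx (mem_connectedComponentIn hτ) ⟨not_lt.1 hxy, hτy₀.le⟩
      exact hy₀ (connectedComponentIn_subset _ _ this)
    · rw [← compl_Ioi]
      refine measure_inter_compl_eq_zero measurableSet_Ioi ?_ (hmin y ⟨hy, hτy⟩)
      exact (le_total y₀ y).imp Ioi_subset_Ioi Ioi_subset_Ioi
  · refine ⟨univ, isOpen_univ, subset_univ _, ⟨n, by simp⟩, subset_univ _,
      hloc _ isOpen_univ fun y hy hτy => (hB ⟨y, hy, hτy⟩).elim⟩

/-- A quantisation of the mass in the gaps of the support forces the same quantisation of the mass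
of the connected components. -/
lemma exists_measureReal_connectedComponentIn_eq (hn : 0 < n)
    (h : ∀ y ∉ measSupp μ, ∃ k : ℕ, n * μ.real (Iio y) = k) {τ : ℝ} (hτ : τ ∈ measSupp μ) :
    ∃ k : ℕ, 1 ≤ k ∧ k ≤ n ∧
      μ.real (connectedComponentIn (measSupp μ) τ) = (k : ℝ) / n := by
  have h' : ∀ y ∉ measSupp μ, ∃ k : ℕ, n * μ.real (Ioi y) = k := by
    intro y hy
    obtain ⟨k, hk⟩ := h y hy
    have h1 : μ.real (Ioi y) = 1 - μ.real (Iio y) := by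
      obtain ⟨ε, hε, hgap⟩ := exists_gap_of_notMem_measSupp hy
      have h2 : μ {y} = 0 :=
        measure_mono_null (singleton_subset_iff.2 (mem_Ioo.2 ⟨by linarith, by linarith⟩)) hgap
      rw [measureReal_congr (Ioi_ae_eq_Ici' h2), ← compl_Iio, measureReal_compl measurableSet_Iio,
        probReal_univ]
    have h2 : k ≤ n := by
      have h3 : (k : ℝ) ≤ n := by
        rw [← hk]
        exact mul_le_of_le_one_right (by positivity) measureReal_le_one
      exact_mod_cast h3
    refine ⟨n - k, ?_⟩
    rw [h1, mul_sub, hk, mul_one, Nat.cast_sub h2]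
  obtain ⟨U, hU, hτU, ⟨k₁, hk₁⟩, hCU, hU0⟩ := exists_right_cut hn h hτ
  obtain ⟨V, hV, hτV, ⟨k₂, hk₂⟩, hCV, hV0⟩ := exists_left_cut hn h' hτ
  set C := connectedComponentIn (measSupp μ) τ
  have hC : μ C = μ (U ∩ V) := by
    refine measure_eq_measure_of_null_sdiff (subset_inter hCU hCV) ?_
    refine measure_mono_null (fun x hx => ?_) (measure_union_null hU0 hV0)
    rcases lt_trichotomy x τ with h1 | h1 | h1
    · exact .inr ⟨hx.1.2, h1, hx.2⟩
    · exact (hx.2 (h1 ▸ mem_connectedComponentIn hτ)).elim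
    · exact .inl ⟨hx.1.1, h1, hx.2⟩
  have hCr : μ.real C = μ.real (U ∩ V) := congrArg ENNReal.toReal hC
  have hpos : 0 < μ.real (U ∩ V) := by
    have h1 := measure_ne_zero_of_mem_measSupp hτ
      ((hU.inter hV).mem_nhds ⟨hτU self_mem_Iic, hτV self_mem_Ici⟩)
    exact measureReal_nonneg.lt_of_ne fun h2 => h1 ((measureReal_eq_zero_iff).1 h2.symm)
  have hun : U ∪ V = univ :=
    eq_univ_of_forall fun x => (le_total x τ).imp (fun h => hτU h) fun h => hτV h
  have hsum := measureReal_union_add_inter (μ := μ) (s := U) hV.measurableSet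
  rw [hun, probReal_univ] at hsum
  have hn' : (0 : ℝ) < n := by exact_mod_cast hn
  have hk : (n : ℝ) * μ.real (U ∩ V) = k₁ + k₂ - n := by
    rw [← hk₁, ← hk₂, eq_sub_of_add_eq' hsum]
    ring
  have hlt : n < k₁ + k₂ := by
    have : (0 : ℝ) < k₁ + k₂ - n := hk ▸ mul_pos hn' hpos
    have h3 : (n : ℝ) < (k₁ + k₂ : ℕ) := by push_cast; linarith
    exact_mod_cast h3
  have hk' : (n : ℝ) * μ.real (U ∩ V) = (k₁ + k₂ - n : ℕ) := by
    rw [hk, Nat.cast_sub hlt.le, Nat.cast_add]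
  refine ⟨k₁ + k₂ - n, by omega, ?_, ?_⟩
  · have h3 : ((k₁ + k₂ - n : ℕ) : ℝ) ≤ n := by
      rw [← hk']
      exact mul_le_of_le_one_right hn'.le measureReal_le_one
    exact_mod_cast h3
  · rw [hCr, ← hk']
    field_simp

lemma finite_components_of_measureReal_ge {F : Set ℝ} (hn : 0 < n)
    (h : ∀ τ ∈ F, (n : ℝ)⁻¹ ≤ μ.real (connectedComponentIn F τ)) :
    {J : Set ℝ | ∃ τ ∈ F, J = connectedComponentIn F τ}.Finite ∧
      {J : Set ℝ | ∃ τ ∈ F, J = connectedComponentIn F τ}.ncard ≤ n := by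
  have hn' : (0 : ℝ) < n := by exact_mod_cast hn
  set 𝒥 := {J : Set ℝ | ∃ τ ∈ F, J = connectedComponentIn F τ}
  have hcard : ∀ t : Finset (Set ℝ), (t : Set (Set ℝ)) ⊆ 𝒥 → t.card ≤ n := by
    intro t ht
    have hdisj : PairwiseDisjoint (t : Set (Set ℝ)) id := by
      intro J hJ J' hJ' hne
      obtain ⟨x, _, rfl⟩ := ht hJ
      obtain ⟨y, _, rfl⟩ := ht hJ'
      refine disjoint_left.2 fun z hz hz' => hne ?_
      exact (connectedComponentIn_eq hz).trans (connectedComponentIn_eq hz').symm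
    have hmeas : ∀ J ∈ t, MeasurableSet (id J) := by
      intro J hJ
      obtain ⟨x, _, rfl⟩ := ht hJ
      exact (isPreconnected_connectedComponentIn (F := F) (x := x)).ordConnected.measurableSet
    have h1 := measureReal_biUnion_finset (μ := μ) hdisj hmeas
    have h2 : (t.card : ℝ) * (n : ℝ)⁻¹ ≤ ∑ J ∈ t, μ.real (id J) := by
      rw [← nsmul_eq_mul]
      refine Finset.card_nsmul_le_sum _ _ _ fun J hJ => ?_
      obtain ⟨x, hx, rfl⟩ := ht hJ
      exact h x hx
    have h3 : (t.card : ℝ) * (n : ℝ)⁻¹ ≤ 1 := h2.trans (h1 ▸ measureReal_le_one)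
    rw [← div_eq_mul_inv, div_le_one hn'] at h3
    exact_mod_cast h3
  have hfin : 𝒥.Finite := by
    by_contra hinf
    obtain ⟨t, ht, htc⟩ := Set.Infinite.exists_subset_card_eq hinf (n + 1)
    have := hcard t ht
    omega
  refine ⟨hfin, ?_⟩
  rw [ncard_eq_toFinset_card _ hfin]
  exact hcard _ (by simp)

end Components

section Representation

/-- The trace of an idempotent complex matrix is a natural number. -/
lemma exists_trace_eq_natCast_of_isIdempotent {n : ℕ} {M : Matrix (Fin n) (Fin n) ℂ}
    (hM : M * M = M) : ∃ k : ℕ, M.trace = k := by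
  have hid : IsIdempotentElem (Matrix.toLin' M) := by
    rw [IsIdempotentElem, Module.End.mul_eq_comp, ← Matrix.toLin'_mul, hM]
  exact ⟨_, (Matrix.trace_toLin'_eq M).symm.trans
    (LinearMap.IsProj.trace (LinearMap.isProj_range_iff_isIdempotentElem _ |>.2 hid))⟩

variable {A : Type*} [CStarAlgebra A] [PartialOrder A] {φ : TracialState A}
  {a : A} {S : A →L[ℂ] A} {m : ℂ → A} {v : OpMeasure A φ} {n : ℕ}

lemma exists_mul_tr_re_eq_natCast (hn : 0 < n) (ψ : A →⋆ₐ[ℂ] Matrix (Fin n) (Fin n) ℂ)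
    (hψ : ∀ x : A, φ.tr x = Matrix.trace (ψ x) / (n : ℂ)) {p : A} (hp : p * p = p) :
    ∃ k : ℕ, n * (φ.tr p).re = k := by
  obtain ⟨k, hk⟩ := exists_trace_eq_natCast_of_isIdempotent (M := ψ p) (by rw [← map_mul, hp])
  refine ⟨k, ?_⟩
  have hn' : (n : ℝ) ≠ 0 := by positivity
  have h1 : φ.tr p = ((k / n : ℝ) : ℂ) := by rw [hψ, hk]; push_cast; rfl
  rw [h1, Complex.ofReal_re]
  field_simp

variable [StarOrderedRing A]

/-- Off the support of the density of states, the normalised mass of a half-line is an integer. -/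
theorem exists_mul_dos_Iio_eq_natCast (ha : IsSelfAdjoint a) (hS : PosPreserving S)
    (hSsym : SymmOp φ S) (hm : IsDysonSolution a S m) (hv : v.val univ = 1)
    (hrep : StieltjesRep φ v m) (hn : 0 < n) (ψ : A →⋆ₐ[ℂ] Matrix (Fin n) (Fin n) ℂ)
    (hψ : ∀ x : A, φ.tr x = Matrix.trace (ψ x) / (n : ℂ)) {τ : ℝ} (hτ : τ ∉ measSupp v.dos) :
    ∃ k : ℕ, n * v.dos.real (Iio τ) = k := by
  obtain ⟨x, y, hx, hxy, hyx, -, hg⟩ := exists_boundary_value ha hS hSsym hm hv hrep hτ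
  obtain ⟨δ, hδ, hspec⟩ := exists_forall_mem_spectrum_le_abs hxy hyx
  let g : ℝ → ℝ := fun t => max 0 (min 1 (-t / δ))
  have hgc : Continuous g := by fun_prop
  have hneg : ∀ t ∈ spectrum ℝ x, t < 0 → g t = 1 := by
    intro t ht h0
    have h1 : 1 ≤ -t / δ := by
      rw [le_div_iff₀ hδ, one_mul, ← abs_of_neg h0]
      exact hspec t ht
    simp [g, min_eq_left h1]
  have hpos : ∀ t ∈ spectrum ℝ x, 0 ≤ t → g t = 0 := fun t _ h0 =>
    max_eq_left ((min_le_right _ _).trans (div_nonpos_of_nonpos_of_nonneg (by linarith) hδ.le))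
  have hidem : cfc g x * cfc g x = cfc g x := by
    rw [← cfc_mul g g x]
    refine cfc_congr fun t ht => ?_
    rcases lt_or_ge t 0 with h0 | h0
    · simp [hneg t ht h0]
    · simp [hpos t ht h0]
  obtain ⟨k, hk⟩ := exists_mul_tr_re_eq_natCast hn ψ hψ hidem
  exact ⟨k, by rw [measureReal_def, hg g hgc hneg hpos, hk]⟩

end Representation

end Dyson

open Dyson in
/-- **Proposition (band mass formula).**
(i) For `τ ∉ supp ρ` the solution extends to a self-adjoint limit `m(τ)` and the band
mass formula `ρ((−∞,τ)) = ⟨χ_{(−∞,0)}(m(τ))⟩` holds, where the spectral projection is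
computed via the (continuous) functional calculus with any continuous function equal to
the indicator of `(−∞,0)` on the spectrum of `m(τ)`.
(ii) If `𝒜` is faithfully represented in `ℂ^{n×n}` with `⟨x⟩ = Tr(π(x))/n`, then
`n·ρ(J) ∈ {1,…,n}` for every connected component `J` of `supp ρ`; in particular `supp ρ`
has at most `n` connected components. -/
theorem band_mass_formula
    {A : Type*} [CStarAlgebra A] [PartialOrder A] [StarOrderedRing A]
    (φ : TracialState A) (a : A) (S : A →L[ℂ] A) (m : ℂ → A) (v : OpMeasure A φ)
    (ha : IsSelfAdjoint a)
    (hS : PosPreserving S) (hSsym : SymmOp φ S)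
    (Cs : ℝ) (hCs : 0 < Cs)
    (hupper : ∀ x : A, 0 ≤ x → S x ≤ Complex.ofReal (Cs * (φ.tr x).re) • (1 : A))
    (hm : IsDysonSolution a S m)
    (hv : v.val Set.univ = 1) (hrep : StieltjesRep φ v m) :
    (∀ τ : ℝ, τ ∉ measSupp v.dos →
      ∃ mτ : A, IsSelfAdjoint mτ ∧
        Filter.Tendsto (fun η : ℝ => m ((τ : ℂ) + (η : ℂ) * Complex.I))
          (nhdsWithin 0 (Set.Ioi 0)) (nhds mτ) ∧
        ∀ g : ℝ → ℝ, Continuous g →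
          (∀ t ∈ spectrum ℝ mτ, t < 0 → g t = 1) →
          (∀ t ∈ spectrum ℝ mτ, 0 ≤ t → g t = 0) →
          (v.dos (Set.Iio τ)).toReal = (φ.tr (cfc g mτ)).re) ∧
    (∀ n : ℕ, 0 < n → ∀ ψ : A →⋆ₐ[ℂ] Matrix (Fin n) (Fin n) ℂ,
      Function.Injective ψ →
      (∀ x : A, φ.tr x = Matrix.trace (ψ x) / (n : ℂ)) →
      (∀ τ ∈ measSupp v.dos,
        ∃ k : ℕ, 1 ≤ k ∧ k ≤ n ∧
          (v.dos (connectedComponentIn (measSupp v.dos) τ)).toReal = (k : ℝ) / n) ∧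
      {J : Set ℝ | ∃ τ ∈ measSupp v.dos,
          J = connectedComponentIn (measSupp v.dos) τ}.Finite ∧
      Set.ncard {J : Set ℝ | ∃ τ ∈ measSupp v.dos,
          J = connectedComponentIn (measSupp v.dos) τ} ≤ n) := by
  have := isProbabilityMeasure_dos hv
  refine ⟨fun τ hτ => ?_, fun n hn ψ _ hψ => ?_⟩
  · obtain ⟨x, -, hx, -, -, hlim, hg⟩ := exists_boundary_value ha hS hSsym hm hv hrep hτ
    exact ⟨x, hx, hlim, hg⟩
  · have hcomp : ∀ τ ∈ measSupp v.dos, ∃ k : ℕ, 1 ≤ k ∧ k ≤ n ∧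
        v.dos.real (connectedComponentIn (measSupp v.dos) τ) = (k : ℝ) / n := fun τ hτ =>
      exists_measureReal_connectedComponentIn_eq hn
        (fun y hy => exists_mul_dos_Iio_eq_natCast ha hS hSsym hm hv hrep hn ψ hψ hy) hτ
    refine ⟨hcomp, finite_components_of_measureReal_ge (μ := v.dos) hn fun τ hτ => ?_⟩
    obtain ⟨k, hk, -, h⟩ := hcomp τ hτ
    rw [h, inv_eq_one_div]
    gcongr
    exact_mod_cast hk
end
end

section
/- Let T : 𝒜 → 𝒜 be a positivity-preserving linear operator that is symmetric with respect to the scalar product ⟨x,y⟩ = ⟨x*y⟩. If there exist h ∈ 𝒜 and ε > 0 such that h ≥ ε·1 and T[h] ≤ h, then ‖T‖₂ ≤ 1, where ‖T‖₂ denotes the operator norm of T with respect to the norm ‖x‖₂ = ⟨x*x⟩^{1/2}. -/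
open MeasureTheory

noncomputable section

/-- A bounded sequence with nonnegative second differences does not increase initially. -/
theorem apply_one_le_apply_zero_of_bddAbove {u : ℕ → ℝ} {C : ℝ} (hC : ∀ n, u n ≤ C)
    (hu : ∀ n, 2 * u (n + 1) ≤ u n + u (n + 2)) : u 1 ≤ u 0 := by
  by_contra! hlt
  have step (n : ℕ) : u 1 - u 0 ≤ u (n + 1) - u n := by
    induction n with
    | zero => simp
    | succ n ih => linarith [hu n]
  have lower (n : ℕ) : u 0 + n * (u 1 - u 0) ≤ u n := by
    induction n with
    | zero => simp
    | succ n ih =>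
      push_cast
      linarith [step n]
  obtain ⟨n, hn⟩ := exists_nat_gt ((C - u 0) / (u 1 - u 0))
  rw [div_lt_iff₀ (by linarith)] at hn
  linarith [lower n, hC n]

namespace Dyson

open scoped ComplexOrder

variable {A : Type*} [CStarAlgebra A] [PartialOrder A]

theorem nrm2_nonneg (φ : TracialState A) (x : A) : 0 ≤ nrm2 φ x := Real.sqrt_nonneg _

/-- The functional of a tracial state, as a positive linear map. -/
def TracialState.toPositive [StarOrderedRing A] (φ : TracialState A) : A →ₚ[ℂ] ℂ :=
  PositiveLinearMap.mk₀ φ.tr fun x hx =>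
    Complex.nonneg_iff.2 ⟨(φ.state_pos x hx).1, (φ.state_pos x hx).2.symm⟩

variable [StarOrderedRing A]

theorem nrm2_eq_norm (φ : TracialState A) (x : A) :
    nrm2 φ x = ‖φ.toPositive.toPreGNS x‖ := rfl

theorem norm_inner2_self (φ : TracialState A) (x : A) : ‖inner2 φ x x‖ = nrm2 φ x ^ 2 := by
  have := φ.toPositive.preGNS_norm_sq (φ.toPositive.toPreGNS x)
  change _ = inner2 φ x x at this
  rw [← this, nrm2_eq_norm]
  simp

theorem norm_inner2_le (φ : TracialState A) (x y : A) :
    ‖inner2 φ x y‖ ≤ nrm2 φ x * nrm2 φ y :=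
  norm_inner_le_norm (𝕜 := ℂ) (φ.toPositive.toPreGNS x) (φ.toPositive.toPreGNS y)

theorem exists_nrm2_le (φ : TracialState A) : ∃ K : ℝ, 0 ≤ K ∧ ∀ x, nrm2 φ x ≤ K * ‖x‖ := by
  let f : A →L[ℂ] ℂ := ⟨φ.tr, φ.cont⟩
  refine ⟨√‖f‖, Real.sqrt_nonneg _, fun x => ?_⟩
  refine (sq_le_sq₀ (nrm2_nonneg φ x) (by positivity)).1 ?_
  rw [← norm_inner2_self, mul_pow, Real.sq_sqrt (norm_nonneg _), sq ‖x‖,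
    ← CStarRing.norm_star_mul_self]
  exact f.le_opNorm (star x * x)

/-- The orbits of a positivity-preserving map with a strictly positive subinvariant element
are bounded in norm. -/
theorem PosPreserving.exists_norm_iterate_le {T : A →L[ℂ] A} (hT : PosPreserving T)
    {h : A} {ε : ℝ} (hε : 0 < ε) (hh : Complex.ofReal ε • (1 : A) ≤ h) (hTh : T h ≤ h) (x : A) :
    ∃ C : ℝ, ∀ n, ‖(T ^ n) x‖ ≤ C := by
  have hx : x ∈ Submodule.span ℂ {a : A | 0 ≤ a} := by simp [CStarAlgebra.span_nonneg]
  induction hx using Submodule.span_induction with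
  | mem x hx =>
    have hx : 0 ≤ x := hx
    set c : ℝ := ‖x‖ / ε
    have hc : 0 ≤ c := by positivity
    have mono {a b : A} (hab : a ≤ b) : T a ≤ T b := by
      simpa using hT _ (sub_nonneg.2 hab)
    have hxh : x ≤ c • h := calc
      x ≤ algebraMap ℝ A ‖x‖ := IsSelfAdjoint.le_algebraMap_norm_self (.of_nonneg hx)
      _ = c • (Complex.ofReal ε • (1 : A)) := by
        rw [Complex.coe_smul, smul_smul, div_mul_cancel₀ _ hε.ne', Algebra.algebraMap_eq_smul_one]
      _ ≤ c • h := smul_le_smul_of_nonneg_left hh hc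
    have key (n : ℕ) : 0 ≤ (T ^ n) x ∧ (T ^ n) x ≤ c • h := by
      induction n with
      | zero => exact ⟨hx, hxh⟩
      | succ n ih =>
        rw [pow_succ', mul_apply_eq_comp]
        refine ⟨hT _ ih.1, (mono ih.2).trans ?_⟩
        rw [← Complex.coe_smul, map_smul, Complex.coe_smul, Complex.coe_smul]
        exact smul_le_smul_of_nonneg_left hTh hc
    exact ⟨‖c • h‖, fun n => CStarAlgebra.norm_le_norm_of_nonneg_of_le (key n).1 (key n).2⟩
  | zero => exact ⟨0, by simp⟩
  | add x y _ _ ihx ihy =>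
    obtain ⟨C, hC⟩ := ihx
    obtain ⟨D, hD⟩ := ihy
    refine ⟨C + D, fun n => ?_⟩
    rw [map_add]
    exact (norm_add_le _ _).trans (add_le_add (hC n) (hD n))
  | smul a x _ ih =>
    obtain ⟨C, hC⟩ := ih
    refine ⟨‖a‖ * C, fun n => ?_⟩
    rw [map_smul, norm_smul]
    exact mul_le_mul_of_nonneg_left (hC n) (norm_nonneg a)

theorem SymmOp.nrm2_sq_le {φ : TracialState A} {T : A →L[ℂ] A} (hsym : SymmOp φ T) (x : A) :
    nrm2 φ (T x) ^ 2 ≤ nrm2 φ x * nrm2 φ (T (T x)) := by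
  have : inner2 φ (T x) (T x) = inner2 φ x (T (T x)) := hsym x (T x)
  rw [← norm_inner2_self, this]
  exact norm_inner2_le φ x _

end Dyson

open Dyson in
/-- **Lemma.** A positivity-preserving, symmetric operator `T` admitting an element
`h ≥ ε·1` with `T[h] ≤ h` is an `L²`-contraction: `‖T‖₂ ≤ 1`. -/
theorem l2_contraction_of_subinvariant_element
    {A : Type*} [CStarAlgebra A] [PartialOrder A] [StarOrderedRing A]
    (φ : TracialState A) (T : A →L[ℂ] A)
    (hT : PosPreserving T) (hsym : SymmOp φ T)
    (h : A) (ε : ℝ) (hε : 0 < ε)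
    (hh : Complex.ofReal ε • (1 : A) ≤ h) (hTh : T h ≤ h) :
    ∀ x : A, nrm2 φ (T x) ≤ nrm2 φ x := by
  intro x
  obtain ⟨K, hK, hKx⟩ := exists_nrm2_le φ
  obtain ⟨C, hC⟩ := hT.exists_norm_iterate_le hε hh hTh x
  have hbdd (n : ℕ) : nrm2 φ ((T ^ n) x) ≤ K * C :=
    (hKx _).trans (mul_le_mul_of_nonneg_left (hC n) hK)
  have hconv (n : ℕ) : 2 * nrm2 φ ((T ^ (n + 1)) x) ≤
      nrm2 φ ((T ^ n) x) + nrm2 φ ((T ^ (n + 2)) x) := by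
    have hsq := hsym.nrm2_sq_le ((T ^ n) x)
    rw [pow_succ' T (n + 1), pow_succ' T n]
    simp only [mul_apply_eq_comp]
    refine le_of_abs_le (abs_le_of_sq_le_sq ?_
      (add_nonneg (nrm2_nonneg φ _) (nrm2_nonneg φ _)))
    nlinarith [sq_nonneg (nrm2 φ ((T ^ n) x) - nrm2 φ (T (T ((T ^ n) x))))]
  simpa using apply_one_le_apply_zero_of_bddAbove hbdd hconv
end
end
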